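/- (Local energy estimate (2.2).) There is a universal constant c > 0 such that for every suitable weak solution (v,p) of the Navier–Stokes equations in Q and every 0 < R ≤ 1 one has A(R/2) + E(R/2) ≤ c [ C^{2/3}(R) + C(R) + C^{1/3}(R) D₀^{2/3}(R) ]. -/

import Mathlib

open MeasureTheory Metric Set

noncomputable section

/-- Three-dimensional Euclidean space. -/
abbrev E3 := EuclideanSpace ℝ (Fin 3)

/-- The open ball `B(r) ⊆ ℝ³` of radius `r` centered at the origin. -/
def ballB (r : ℝ) : Set E3 := Metric.ball (0 : E3) r

/-- The time interval `(-r², 0)`. -/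
def timeI (r : ℝ) : Set ℝ := Set.Ioo (-r ^ 2) 0

/-- The parabolic cylinder `Q(r) = B(r) × (-r², 0)`. -/
def QSet (r : ℝ) : Set (E3 × ℝ) := ballB r ×ˢ timeI r

/-- The mean value `[f]_{B(r)}` of a function over the ball `B(r)`. -/
def avgB (r : ℝ) (f : E3 → ℝ) : ℝ := ⨍ x in ballB r, f x

/-- `A(r) = ess sup_{-r²<t<0} (1/r) ∫_{B(r)} |v(x,t)|² dx`. -/
def funA (v : E3 → ℝ → E3) (r : ℝ) : ℝ :=
  essSup (fun t => (1 / r) * ∫ x in ballB r, ‖v x t‖ ^ 2)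
    (volume.restrict (timeI r))

/-- `E(r) = (1/r) ∫_{Q(r)} |∇v|² dz`, where `gv` is the (weak) spatial gradient of `v`. -/
def funE (gv : E3 → ℝ → Fin 3 → Fin 3 → ℝ) (r : ℝ) : ℝ :=
  (1 / r) * ∫ t in timeI r, ∫ x in ballB r, ∑ i, ∑ j, (gv x t i j) ^ 2

/-- `C(r) = (1/r²) ∫_{Q(r)} |v|³ dz`. -/
def funC (v : E3 → ℝ → E3) (r : ℝ) : ℝ :=
  (1 / r ^ 2) * ∫ t in timeI r, ∫ x in ballB r, ‖v x t‖ ^ 3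

/-- `D₀(r) = (1/r²) ∫_{Q(r)} |p - [p]_{B(r)}|^{3/2} dz`. -/
def funD0 (p : E3 → ℝ → ℝ) (r : ℝ) : ℝ :=
  (1 / r ^ 2) * ∫ t in timeI r, ∫ x in ballB r,
    |p x t - avgB r (fun y => p y t)| ^ ((3 : ℝ) / 2)

/-- The `j`-th spatial coordinate direction in space-time `ℝ³ × ℝ`. -/
def spaceDir (j : Fin 3) : E3 × ℝ := (EuclideanSpace.single j (1 : ℝ), 0)

/-- The time direction in space-time `ℝ³ × ℝ`. -/
def timeDir : E3 × ℝ := (0, 1)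

/-- The spatial Laplacian of a space-time test function. -/
def lapSpace (φ : E3 × ℝ → ℝ) (z : E3 × ℝ) : ℝ :=
  ∑ j, fderiv ℝ (fun w => fderiv ℝ φ w (spaceDir j)) z (spaceDir j)

/-- `gv` is the weak spatial gradient of `v` on `B(ϱ)`, for a.e. time in `(-ϱ², 0)`:
integration by parts against smooth test functions compactly supported in `B(ϱ)`. -/
def IsWeakSpatialGradient (v : E3 → ℝ → E3) (gv : E3 → ℝ → Fin 3 → Fin 3 → ℝ)
    (ϱ : ℝ) : Prop :=
  ∀ᵐ t ∂(volume.restrict (timeI ϱ)),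
    ∀ φ : E3 → ℝ, ContDiff ℝ (⊤ : ℕ∞) φ → tsupport φ ⊆ ballB ϱ →
      ∀ i j, ∫ x in ballB ϱ, v x t i * fderiv ℝ φ x (EuclideanSpace.single j (1 : ℝ))
        = - ∫ x in ballB ϱ, gv x t i j * φ x

/-- The regularity class `v ∈ L_∞(-ϱ²,0;L₂(B(ϱ))) ∩ L₂(-ϱ²,0;W¹₂(B(ϱ)))`,
with weak spatial gradient `gv ∈ L₂(Q(ϱ))`. -/
structure VelocityClass (v : E3 → ℝ → E3) (gv : E3 → ℝ → Fin 3 → Fin 3 → ℝ)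
    (ϱ : ℝ) : Prop where
  v_meas : AEMeasurable (fun z : E3 × ℝ => v z.1 z.2) (volume.restrict (QSet ϱ))
  v_L2 : IntegrableOn (fun z : E3 × ℝ => ‖v z.1 z.2‖ ^ 2) (QSet ϱ)
  v_Linfty : ∃ M : ℝ, ∀ᵐ t ∂(volume.restrict (timeI ϱ)),
      (∫ x in ballB ϱ, ‖v x t‖ ^ 2) ≤ M
  grad_L2 : IntegrableOn (fun z : E3 × ℝ => ∑ i, ∑ j, (gv z.1 z.2 i j) ^ 2) (QSet ϱ)
  isGrad : IsWeakSpatialGradient v gv ϱ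

/-- The Navier–Stokes equations hold in `Q = Q(1)` in the sense of distributions. -/
def NSEDistrib (v : E3 → ℝ → E3) (gv : E3 → ℝ → Fin 3 → Fin 3 → ℝ)
    (p : E3 → ℝ → ℝ) : Prop :=
  (∀ φ : E3 × ℝ → E3, ContDiff ℝ (⊤ : ℕ∞) φ → tsupport φ ⊆ QSet 1 →
    (∫ z in QSet 1,
      ((∑ i, v z.1 z.2 i * fderiv ℝ (fun w => φ w i) z timeDir)
        + (∑ i, ∑ j, v z.1 z.2 i * v z.1 z.2 j * fderiv ℝ (fun w => φ w i) z (spaceDir j))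
        - (∑ i, ∑ j, gv z.1 z.2 i j * fderiv ℝ (fun w => φ w i) z (spaceDir j))
        + p z.1 z.2 * (∑ i, fderiv ℝ (fun w => φ w i) z (spaceDir i)))) = 0)
  ∧
  (∀ q : E3 × ℝ → ℝ, ContDiff ℝ (⊤ : ℕ∞) q → tsupport q ⊆ QSet 1 →
    (∫ z in QSet 1, ∑ i, v z.1 z.2 i * fderiv ℝ q z (spaceDir i)) = 0)

/-- The parabolic boundary of `Q = B(1) × (-1,0)`. -/
def parabBdry : Set (E3 × ℝ) :=
  (Metric.sphere (0 : E3) 1 ×ˢ Set.Icc (-1 : ℝ) 0)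
    ∪ (Metric.closedBall (0 : E3) 1 ×ˢ {(-1 : ℝ)})

/-- The local energy inequality for a suitable weak solution on `Q = Q(1)`. -/
def LocalEnergyIneq (v : E3 → ℝ → E3) (gv : E3 → ℝ → Fin 3 → Fin 3 → ℝ)
    (p : E3 → ℝ → ℝ) : Prop :=
  ∀ᵐ t ∂(volume.restrict (Set.Ioo (-1 : ℝ) 0)),
    ∀ φ : E3 × ℝ → ℝ, ContDiff ℝ (⊤ : ℕ∞) φ → (∀ z, 0 ≤ φ z) →
      (∃ U : Set (E3 × ℝ), IsOpen U ∧ parabBdry ⊆ U ∧ ∀ z ∈ U, φ z = 0) →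
      (∫ x in ballB 1, φ (x, t) * ‖v x t‖ ^ 2)
        + 2 * ∫ s in Set.Ioo (-1 : ℝ) t, ∫ x in ballB 1,
            φ (x, s) * ∑ i, ∑ j, (gv x s i j) ^ 2
      ≤ ∫ s in Set.Ioo (-1 : ℝ) t, ∫ x in ballB 1,
          (‖v x s‖ ^ 2 * (lapSpace φ (x, s) + fderiv ℝ φ (x, s) timeDir)
            + (∑ i, v x s i * fderiv ℝ φ (x, s) (spaceDir i)) * (‖v x s‖ ^ 2 + 2 * p x s))

/-- `(v, p)` is a suitable weak solution of the Navier–Stokes equations in `Q = Q(1)`,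
with `gv` the weak spatial gradient of `v`. -/
structure SuitableWeakSolution (v : E3 → ℝ → E3) (gv : E3 → ℝ → Fin 3 → Fin 3 → ℝ)
    (p : E3 → ℝ → ℝ) : Prop where
  vel : VelocityClass v gv 1
  p_meas : AEMeasurable (fun z : E3 × ℝ => p z.1 z.2) (volume.restrict (QSet 1))
  p_L32 : IntegrableOn (fun z : E3 × ℝ => |p z.1 z.2| ^ ((3 : ℝ) / 2)) (QSet 1)
  nse : NSEDistrib v gv p
  lei : LocalEnergyIneq v gv p

/-! ### Mollification along a cone condition in the unit ball -/

/-- A smooth kernel of unit mass supported in the ball of radius `1/2`, with explicit bounds. -/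
structure IsMollifier (ψ : E3 → ℝ) (M : ℝ) : Prop where
  smooth : ContDiff ℝ (⊤ : ℕ∞) ψ
  bound : ∀ x, ‖ψ x‖ ≤ M
  fderiv_bound : ∀ x, ‖fderiv ℝ ψ x‖ ≤ M
  supp : ∀ x, 1 / 2 < ‖x‖ → ψ x = 0
  integral_eq : ∫ x, ψ x = 1

lemma exists_isMollifier : ∃ (ψ : E3 → ℝ) (M : ℝ), IsMollifier ψ M := by
  let b : ContDiffBump (0 : E3) := ⟨1 / 4, 1 / 2, by norm_num, by norm_num⟩
  have hs : ContDiff ℝ (⊤ : ℕ∞) (b.normed volume) := b.contDiff_normed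
  have hc : HasCompactSupport (b.normed volume) := b.hasCompactSupport_normed
  obtain ⟨M₁, h₁⟩ := hc.exists_bound_of_continuous hs.continuous
  obtain ⟨M₂, h₂⟩ := (hc.fderiv ℝ).exists_bound_of_continuous
    (hs.continuous_fderiv (by simp))
  refine ⟨b.normed volume, max M₁ M₂, hs, fun x => (h₁ x).trans (le_max_left _ _),
    fun x => (h₂ x).trans (le_max_right _ _), fun x hx => ?_, b.integral_normed⟩
  have : x ∉ Function.support (b.normed volume) := by
    rw [b.support_normed_eq]
    simpa [b] using hx.le
  simpa using this

/-- Average of `u` over a ball of radius comparable to `1 / l` lying inside the cone spanned by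
`x` and the ball of radius `1/2`. -/
def coneAvg (ψ : E3 → ℝ) (u : E3 → ℝ) (l : ℝ) (x : E3) : ℝ :=
  ∫ z in ballB 1, u z * (l ^ 3 * ψ (x + l • (z - x)))

lemma measurableSet_ballB (r : ℝ) : MeasurableSet (ballB r) := measurableSet_ball

lemma mem_ballB {r : ℝ} {x : E3} : x ∈ ballB r ↔ ‖x‖ < r := by simp [ballB]

instance (r : ℝ) : IsFiniteMeasure ((volume : Measure E3).restrict (ballB r)) :=
  ⟨by rw [Measure.restrict_apply_univ]; exact measure_ball_lt_top⟩

namespace IsMollifier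

variable {ψ : E3 → ℝ} {M : ℝ}

lemma nonneg (h : IsMollifier ψ M) : 0 ≤ M := (norm_nonneg _).trans (h.bound 0)

lemma eq_zero_of_lt (h : IsMollifier ψ M) {x z : E3} {l : ℝ} (hl : 1 ≤ l) (hx : ‖x‖ < 1)
    (hz : 2 / l < ‖z - x‖) : ψ (x + l • (z - x)) = 0 := by
  apply h.supp
  have h1 : 2 < l * ‖z - x‖ := by
    rw [div_lt_iff₀ (by linarith)] at hz; linarith
  have h2 : ‖l • (z - x)‖ ≤ ‖x + l • (z - x)‖ + ‖x‖ := by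
    calc ‖l • (z - x)‖ = ‖(x + l • (z - x)) - x‖ := by congr 1; abel
      _ ≤ _ := norm_sub_le _ _
  rw [norm_smul, Real.norm_of_nonneg (by linarith)] at h2
  linarith

lemma eq_zero_of_lt_norm (h : IsMollifier ψ M) {x z : E3} {l : ℝ} (hl : 1 ≤ l)
    (hz : ((l - 1) * ‖x‖ + 1 / 2) / l < ‖z‖) : ψ (x + l • (z - x)) = 0 := by
  apply h.supp
  rw [div_lt_iff₀ (by linarith)] at hz
  have h2 : ‖l • z‖ ≤ ‖x + l • (z - x)‖ + ‖(l - 1) • x‖ := by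
    calc ‖l • z‖ = ‖(x + l • (z - x)) + (l - 1) • x‖ := by congr 1; module
      _ ≤ _ := norm_add_le _ _
  rw [norm_smul, norm_smul, Real.norm_of_nonneg (by linarith), Real.norm_of_nonneg (by linarith)]
    at h2
  linarith

lemma hasFDerivAt_comp (h : IsMollifier ψ M) (x z : E3) (l : ℝ) :
    HasFDerivAt (fun z => ψ (x + l • (z - x))) (l • fderiv ℝ ψ (x + l • (z - x))) z := by
  have h1 : HasFDerivAt (fun z : E3 => x + l • (z - x)) (l • ContinuousLinearMap.id ℝ E3) z :=
    (((hasFDerivAt_id z).sub_const x).const_smul l).const_add x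
  have h2 := (h.smooth.differentiable (by simp) (x + l • (z - x))).hasFDerivAt.comp z h1
  refine h2.congr_fderiv ?_
  ext v
  simp

lemma hasDerivAt_comp (h : IsMollifier ψ M) (x z : E3) (l : ℝ) :
    HasDerivAt (fun l : ℝ => l ^ 3 * ψ (x + l • (z - x)))
      (3 * l ^ 2 * ψ (x + l • (z - x)) + l ^ 3 * fderiv ℝ ψ (x + l • (z - x)) (z - x)) l := by
  have h1 : HasDerivAt (fun l : ℝ => x + l • (z - x)) (z - x) l := by
    simpa using ((hasDerivAt_id l).smul_const (z - x)).const_add x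
  have h2 := (h.smooth.differentiable (by simp) (x + l • (z - x))).hasFDerivAt.comp_hasDerivAt l h1
  exact ((hasDerivAt_pow 3 l).mul h2).congr_deriv (by simp)

lemma continuous_comp (h : IsMollifier ψ M) (x : E3) (l : ℝ) :
    Continuous (fun z => ψ (x + l • (z - x))) := by
  have := h.smooth.continuous
  fun_prop

lemma integrable_mul (h : IsMollifier ψ M) {u : E3 → ℝ} (hu : IntegrableOn u (ballB 1))
    (x : E3) (l : ℝ) :
    IntegrableOn (fun z => u z * (l ^ 3 * ψ (x + l • (z - x)))) (ballB 1) := by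
  refine Integrable.mul_bdd (c := |l ^ 3| * M) hu
    (continuous_const.mul (h.continuous_comp x l)).aestronglyMeasurable ?_
  refine Filter.Eventually.of_forall fun z => ?_
  rw [norm_mul, Real.norm_eq_abs]
  exact mul_le_mul_of_nonneg_left (h.bound _) (abs_nonneg _)

lemma hasDerivAt_coneAvg (h : IsMollifier ψ M) {u : E3 → ℝ} (hu : IntegrableOn u (ballB 1))
    {x : E3} (hx : ‖x‖ < 1) (l : ℝ) :
    IntegrableOn (fun z => u z * (3 * l ^ 2 * ψ (x + l • (z - x))
        + l ^ 3 * fderiv ℝ ψ (x + l • (z - x)) (z - x))) (ballB 1) ∧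
    HasDerivAt (fun l => coneAvg ψ u l x)
      (∫ z in ballB 1, u z * (3 * l ^ 2 * ψ (x + l • (z - x))
        + l ^ 3 * fderiv ℝ ψ (x + l • (z - x)) (z - x))) l := by
  have hψ := h.smooth.continuous
  have hψ' : Continuous (fderiv ℝ ψ) := h.smooth.continuous_fderiv (by simp)
  have hM := h.nonneg
  refine hasDerivAt_integral_of_dominated_loc_of_deriv_le (Metric.ball_mem_nhds l one_pos)
    (Filter.Eventually.of_forall fun l' => (h.integrable_mul hu x l').aestronglyMeasurable)
    (h.integrable_mul hu x l)
    (F' := fun l z => u z * (3 * l ^ 2 * ψ (x + l • (z - x))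
      + l ^ 3 * fderiv ℝ ψ (x + l • (z - x)) (z - x)))
    (bound := fun z => ‖u z‖ * (3 * (|l| + 1) ^ 2 * M + (|l| + 1) ^ 3 * (M * 2)))
    ?_ ?_ (hu.norm.mul_const _) ?_
  · exact hu.aestronglyMeasurable.mul (Continuous.aestronglyMeasurable (by fun_prop))
  · filter_upwards [ae_restrict_mem (measurableSet_ballB 1)] with z hz l' hl'
    rw [mem_ballB] at hz
    have hl : |l'| ≤ |l| + 1 := by
      have h1 : |l' - l| < 1 := by simpa [Real.dist_eq] using hl'
      have h2 := abs_sub_abs_le_abs_sub l' l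
      linarith
    rw [norm_mul]
    refine mul_le_mul_of_nonneg_left ?_ (norm_nonneg _)
    refine (norm_add_le _ _).trans (add_le_add ?_ ?_)
    · rw [norm_mul, norm_mul, norm_pow, Real.norm_eq_abs l', Real.norm_of_nonneg (by norm_num)]
      gcongr
      exact h.bound _
    · rw [norm_mul, norm_pow, Real.norm_eq_abs l']
      gcongr
      refine (ContinuousLinearMap.le_opNorm _ _).trans ?_
      refine mul_le_mul (h.fderiv_bound _) ?_ (norm_nonneg _) hM
      exact (norm_sub_le _ _).trans (by linarith)
  · exact Filter.Eventually.of_forall fun z l' _ => (h.hasDerivAt_comp x z l').const_mul (u z)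

end IsMollifier

/-- `g` satisfies the integration by parts identities of the weak gradient of `u` in the unit
ball. -/
def HasWeakGrad (u : E3 → ℝ) (g : Fin 3 → E3 → ℝ) : Prop :=
  ∀ φ : E3 → ℝ, ContDiff ℝ (⊤ : ℕ∞) φ → tsupport φ ⊆ ballB 1 →
    ∀ j, ∫ x in ballB 1, u x * fderiv ℝ φ x (EuclideanSpace.single j (1 : ℝ))
      = - ∫ x in ballB 1, g j x * φ x

lemma eq_sum_single (w : E3) : w = ∑ j, w j • EuclideanSpace.single j (1 : ℝ) := by
  ext i
  simp [Finset.sum_apply, Pi.single_apply]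

lemma hasFDerivAt_coord (j : Fin 3) (z : E3) :
    HasFDerivAt (fun z : E3 => z j) (EuclideanSpace.proj j : E3 →L[ℝ] ℝ) z :=
  (EuclideanSpace.proj j : E3 →L[ℝ] ℝ).hasFDerivAt

lemma abs_coord_le (z : E3) (j : Fin 3) : |z j| ≤ ‖z‖ := by
  simpa using PiLp.norm_apply_le z j

lemma integrableOn_mul_fderiv {u φ : E3 → ℝ} (hu : IntegrableOn u (ballB 1))
    (hφ : ContDiff ℝ (⊤ : ℕ∞) φ) (hs : tsupport φ ⊆ ballB 1) (e : E3) :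
    IntegrableOn (fun z => u z * fderiv ℝ φ z e) (ballB 1) := by
  have hc : HasCompactSupport φ :=
    HasCompactSupport.of_support_subset_isCompact (isCompact_closedBall (0 : E3) 1)
      ((subset_tsupport _).trans (hs.trans ball_subset_closedBall))
  have hd : Continuous fun z => fderiv ℝ φ z e :=
    (hφ.continuous_fderiv (by simp)).clm_apply continuous_const
  obtain ⟨C, hC⟩ := (hc.fderiv_apply ℝ e).exists_bound_of_continuous hd
  exact Integrable.mul_bdd (c := C) hu hd.aestronglyMeasurable (Filter.Eventually.of_forall hC)

namespace IsMollifier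

variable {ψ : E3 → ℝ} {M : ℝ}

lemma integral_deriv_eq (h : IsMollifier ψ M) {u : E3 → ℝ} {g : Fin 3 → E3 → ℝ}
    (hu : IntegrableOn u (ballB 1)) (hg : HasWeakGrad u g)
    {x : E3} (hx : ‖x‖ < 1) {l : ℝ} (hl : 1 ≤ l) :
    (∫ z in ballB 1, u z * (3 * l ^ 2 * ψ (x + l • (z - x))
        + l ^ 3 * fderiv ℝ ψ (x + l • (z - x)) (z - x)))
      = - ∑ j, ∫ z in ballB 1, g j z * (l ^ 2 * ψ (x + l • (z - x)) * (z j - x j)) := by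
  have hψ := h.smooth.continuous
  have hψ' : Continuous (fderiv ℝ ψ) := h.smooth.continuous_fderiv (by simp)
  have hM := h.nonneg
  let F : Fin 3 → E3 → ℝ := fun j z => l ^ 2 * ψ (x + l • (z - x)) * (z j - x j)
  have hF : ∀ j, ContDiff ℝ (⊤ : ℕ∞) (F j) := by
    intro j
    have h1 : ContDiff ℝ (⊤ : ℕ∞) (fun z : E3 => z j) :=
      (EuclideanSpace.proj j : E3 →L[ℝ] ℝ).contDiff
    have h2 : ContDiff ℝ (⊤ : ℕ∞) (fun z : E3 => ψ (x + l • (z - x))) :=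
      h.smooth.comp (by fun_prop)
    exact (contDiff_const.mul h2).mul (h1.sub contDiff_const)
  have hsupp : ∀ j, tsupport (F j) ⊆ ballB 1 := by
    intro j
    have h1 : tsupport (F j) ⊆ closedBall 0 (((l - 1) * ‖x‖ + 1 / 2) / l) := by
      refine closure_minimal (fun z hz => ?_) isClosed_closedBall
      by_contra hc
      refine hz ?_
      have : ψ (x + l • (z - x)) = 0 :=
        h.eq_zero_of_lt_norm hl (by simpa using hc)
      simp [F, this]
    refine h1.trans fun z hz => ?_
    rw [mem_ballB]
    have h2 : ‖z‖ ≤ ((l - 1) * ‖x‖ + 1 / 2) / l := by simpa using hz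
    refine h2.trans_lt ?_
    rw [div_lt_one (by linarith)]
    nlinarith
  have hder : ∀ j z, fderiv ℝ (F j) z (EuclideanSpace.single j (1 : ℝ))
      = l ^ 2 * ψ (x + l • (z - x))
        + l ^ 3 * (z j - x j) * fderiv ℝ ψ (x + l • (z - x)) (EuclideanSpace.single j 1) := by
    intro j z
    have h1 := ((h.hasFDerivAt_comp x z l).const_mul (l ^ 2)).mul
      ((hasFDerivAt_coord j z).sub_const (x j))
    have h2 : fderiv ℝ (F j) z = _ := h1.fderiv
    rw [h2]
    simp
    ring
  have hint : ∀ j, IntegrableOn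
      (fun z => u z * fderiv ℝ (F j) z (EuclideanSpace.single j (1 : ℝ))) (ballB 1) :=
    fun j => integrableOn_mul_fderiv hu (hF j) (hsupp j) _
  calc _ = ∫ z in ballB 1, ∑ j, u z * fderiv ℝ (F j) z (EuclideanSpace.single j (1 : ℝ)) := by
        refine integral_congr_ae (Filter.Eventually.of_forall fun z => ?_)
        have h1 := congrArg (fderiv ℝ ψ (x + l • (z - x))) (eq_sum_single (z - x))
        rw [map_sum] at h1
        simp only [hder, h1]
        simp [Fin.sum_univ_three]
        ring
    _ = ∑ j, ∫ z in ballB 1, u z * fderiv ℝ (F j) z (EuclideanSpace.single j (1 : ℝ)) :=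
        integral_finsetSum _ fun j _ => hint j
    _ = _ := by
        rw [← Finset.sum_neg_distrib]
        exact Finset.sum_congr rfl fun j _ => hg (F j) (hF j) (hsupp j) j

lemma norm_integral_deriv_le (h : IsMollifier ψ M) {u : E3 → ℝ} {g : Fin 3 → E3 → ℝ}
    (hu : IntegrableOn u (ballB 1)) (hg : HasWeakGrad u g)
    (hgi : ∀ j, IntegrableOn (g j) (ballB 1))
    {x : E3} (hx : ‖x‖ < 1) {l r : ℝ} (hl : 1 ≤ l) (hr : 2 / l ≤ r) :
    ‖∫ z in ballB 1, u z * (3 * l ^ 2 * ψ (x + l • (z - x))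
        + l ^ 3 * fderiv ℝ ψ (x + l • (z - x)) (z - x))‖
      ≤ 2 * M * l * ∫ z in ballB 1 ∩ closedBall x r, ∑ j, ‖g j z‖ := by
  have hM := h.nonneg
  rw [h.integral_deriv_eq hu hg hx hl, norm_neg]
  have hsum : ∫ z in ballB 1 ∩ closedBall x r, ∑ j, ‖g j z‖
      = ∑ j, ∫ z in ballB 1 ∩ closedBall x r, ‖g j z‖ :=
    integral_finsetSum _ fun j _ => ((hgi j).mono_set inter_subset_left).norm
  rw [hsum, Finset.mul_sum]
  refine (norm_sum_le _ _).trans (Finset.sum_le_sum fun j _ => ?_)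
  rw [← setIntegral_indicator measurableSet_closedBall, ← integral_const_mul]
  refine norm_integral_le_of_norm_le
    (((hgi j).norm.indicator measurableSet_closedBall).const_mul _)
    (Filter.Eventually.of_forall fun z => ?_)
  by_cases hz : z ∈ closedBall x r
  · rw [indicator_of_mem hz, norm_mul, mul_comm]
    refine mul_le_mul_of_nonneg_right ?_ (norm_nonneg _)
    by_cases hz' : 2 / l < ‖z - x‖
    · rw [h.eq_zero_of_lt hl hx hz']
      simp
      positivity
    · rw [norm_mul, norm_mul, norm_pow, Real.norm_of_nonneg (by linarith : 0 ≤ l)]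
      have h1 : ‖z j - x j‖ ≤ 2 / l := (abs_coord_le (z - x) j).trans (not_lt.mp hz')
      calc l ^ 2 * ‖ψ (x + l • (z - x))‖ * ‖z j - x j‖ ≤ l ^ 2 * M * (2 / l) := by
            gcongr
            exact h.bound _
        _ = 2 * M * l := by field_simp
  · rw [indicator_of_notMem hz]
    have hz' : 2 / l < ‖z - x‖ := by
      refine hr.trans_lt ?_
      simpa [dist_eq_norm] using hz
    rw [h.eq_zero_of_lt hl hx hz']
    simp

lemma norm_coneAvg_sub_le (h : IsMollifier ψ M) {u : E3 → ℝ} {g : Fin 3 → E3 → ℝ}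
    (hu : IntegrableOn u (ballB 1)) (hg : HasWeakGrad u g)
    (hgi : ∀ j, IntegrableOn (g j) (ballB 1))
    {x : E3} (hx : ‖x‖ < 1) {l : ℝ} (hl : 1 ≤ l) :
    ‖coneAvg ψ u (16 * l) x - coneAvg ψ u l x‖
      ≤ 512 * M * l ^ 2 * ∫ z in ballB 1 ∩ closedBall x (2 / l), ∑ j, ‖g j z‖ := by
  have hM := h.nonneg
  have hJ : 0 ≤ ∫ z in ballB 1 ∩ closedBall x (2 / l), ∑ j, ‖g j z‖ :=
    integral_nonneg fun z => Finset.sum_nonneg fun j _ => norm_nonneg _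
  set J := ∫ z in ballB 1 ∩ closedBall x (2 / l), ∑ j, ‖g j z‖
  have h1 := Convex.norm_image_sub_le_of_norm_hasDerivWithin_le
    (f := fun l => coneAvg ψ u l x) (s := Icc l (16 * l)) (C := 32 * M * l * J)
    (x := l) (y := 16 * l)
    (fun m _ => (h.hasDerivAt_coneAvg hu hx m).2.hasDerivWithinAt) (fun m hm => ?_)
    (convex_Icc _ _) ⟨le_rfl, by linarith⟩ ⟨by linarith, le_rfl⟩
  · refine h1.trans ?_
    rw [show 16 * l - l = 15 * l by ring, Real.norm_of_nonneg (by linarith)]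
    have : 0 ≤ M * l ^ 2 * J := by positivity
    nlinarith
  · refine (h.norm_integral_deriv_le hu hg hgi hx (hl.trans hm.1) (r := 2 / l) ?_).trans ?_
    · exact div_le_div_of_nonneg_left (by norm_num) (by linarith) hm.1
    · refine mul_le_mul_of_nonneg_right ?_ hJ
      nlinarith [hm.2]

lemma integral_scaled_eq_one (h : IsMollifier ψ M) (x : E3) {l : ℝ} (hl : 0 < l) :
    ∫ z, l ^ 3 * ψ (x + l • (z - x)) = 1 := by
  have h1 := Measure.integral_comp_smul (volume : Measure E3) (fun w => ψ (w + (x - l • x))) l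
  rw [integral_add_right_eq_self, h.integral_eq] at h1
  have h2 : ∀ z : E3, ψ (x + l • (z - x)) = ψ (l • z + (x - l • x)) := fun z => by
    congr 1
    module
  simp only [h2]
  rw [integral_const_mul, h1]
  have h3 : (0 : ℝ) < l ^ 3 := by positivity
  simp [abs_of_pos hl]
  field_simp

lemma tendsto_coneAvg (h : IsMollifier ψ M) {u : E3 → ℝ} (hu : IntegrableOn u (ballB 1)) :
    ∀ᵐ x ∂(volume.restrict (ballB 1)),
      Filter.Tendsto (fun n : ℕ => coneAvg ψ u (16 ^ n) x) Filter.atTop (nhds (u x)) := by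
  have hM := h.nonneg
  set f : E3 → ℝ := (ballB 1).indicator u with hf
  have hfi : Integrable f := hu.integrable_indicator (measurableSet_ballB 1)
  have hleb := IsUnifLocDoublingMeasure.ae_tendsto_average_norm_sub (volume : Measure E3)
    hfi.locallyIntegrable 1
  have hlim : Filter.Tendsto (fun n : ℕ => (2 : ℝ) / 16 ^ n) Filter.atTop
      (nhdsWithin 0 (Set.Ioi 0)) := by
    refine tendsto_nhdsWithin_iff.mpr ⟨?_, Filter.Eventually.of_forall fun n => ?_⟩
    · have := (tendsto_pow_atTop_nhds_zero_of_lt_one (r := (1 / 16 : ℝ)) (by norm_num)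
        (by norm_num)).const_mul 2
      simpa [div_eq_mul_inv] using this
    · simp only [mem_Ioi]
      positivity
  filter_upwards [ae_restrict_of_ae hleb, ae_restrict_mem (measurableSet_ballB 1)] with x hx hxB
  have hxB' := mem_ballB.mp hxB
  have hx0 := hx (fun _ : ℕ => x) (fun n : ℕ => (2 : ℝ) / 16 ^ n) hlim
    (Filter.Eventually.of_forall fun n => mem_closedBall_self (by positivity))
  have hfx : f x = u x := indicator_of_mem hxB u
  rw [tendsto_iff_norm_sub_tendsto_zero]
  have hV : 0 ≤ (volume : Measure E3).real (ball 0 1) := measureReal_nonneg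
  refine squeeze_zero (fun _ => norm_nonneg _) (fun n => ?_)
    (by simpa using hx0.const_mul (8 * M * (volume : Measure E3).real (ball 0 1)))
  set l : ℝ := 16 ^ n with hl
  have hl1 : 1 ≤ l := one_le_pow₀ (by norm_num)
  have hl0 : 0 < l := by linarith
  have hkc : Continuous fun z => l ^ 3 * ψ (x + l • (z - x)) :=
    continuous_const.mul (h.continuous_comp x l)
  have hkb : ∀ z, ‖l ^ 3 * ψ (x + l • (z - x))‖ ≤ l ^ 3 * M := fun z => by
    rw [norm_mul, norm_pow, Real.norm_of_nonneg hl0.le]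
    gcongr
    exact h.bound _
  have h1 : coneAvg ψ u l x = ∫ z, f z * (l ^ 3 * ψ (x + l • (z - x))) := by
    rw [coneAvg, ← integral_indicator (measurableSet_ballB 1)]
    simp only [hf, indicator_mul_left]
  have hki : Integrable fun z => l ^ 3 * ψ (x + l • (z - x)) := by
    refine hkc.integrable_of_hasCompactSupport
      (HasCompactSupport.of_support_subset_isCompact (isCompact_closedBall x (2 / l)) ?_)
    intro z hz
    by_contra hc
    refine hz ?_
    have : ψ (x + l • (z - x)) = 0 :=
      h.eq_zero_of_lt hl1 hxB' (by simpa [dist_eq_norm] using hc)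
    simp [this]
  have h2 : coneAvg ψ u l x - u x = ∫ z, (f z - f x) * (l ^ 3 * ψ (x + l • (z - x))) := by
    simp only [sub_mul]
    rw [integral_sub (hfi.mul_bdd (c := l ^ 3 * M) hkc.aestronglyMeasurable
      (Filter.Eventually.of_forall hkb)) (hki.const_mul _), integral_const_mul,
      h.integral_scaled_eq_one x hl0, h1, hfx, mul_one]
  have hloc : IntegrableOn (fun z => ‖f z - f x‖) (closedBall x (2 / l)) :=
    (hfi.integrableOn.sub (integrableOn_const (measure_closedBall_lt_top.ne))).norm
  have h3 : ‖coneAvg ψ u l x - u x‖ ≤ l ^ 3 * M * ∫ z in closedBall x (2 / l), ‖f z - f x‖ := by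
    rw [h2, ← integral_indicator measurableSet_closedBall, ← integral_const_mul]
    refine norm_integral_le_of_norm_le
      ((hloc.integrable_indicator measurableSet_closedBall).const_mul _)
      (Filter.Eventually.of_forall fun z => ?_)
    by_cases hz : z ∈ closedBall x (2 / l)
    · rw [indicator_of_mem hz, norm_mul, mul_comm]
      exact mul_le_mul_of_nonneg_right (hkb z) (norm_nonneg _)
    · have : ψ (x + l • (z - x)) = 0 :=
        h.eq_zero_of_lt hl1 hxB' (by simpa [dist_eq_norm] using hz)
      simp [indicator_of_notMem hz, this]
  refine h3.trans (le_of_eq ?_)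
  rw [← measure_smul_setAverage _ measure_closedBall_lt_top.ne, smul_eq_mul,
    Measure.addHaar_real_closedBall _ _ (by positivity)]
  simp
  field_simp
  ring

end IsMollifier

lemma sq_lintegral_le {α : Type*} [MeasurableSpace α] (μ : Measure α) {f : α → ENNReal}
    (hf : AEMeasurable f μ) : (∫⁻ x, f x ∂μ) ^ 2 ≤ μ univ * ∫⁻ x, f x ^ 2 ∂μ := by
  have h := ENNReal.lintegral_mul_le_Lp_mul_Lq μ Real.HolderConjugate.two_two hf
    (aemeasurable_const (b := (1 : ENNReal)))
  simp only [Pi.mul_apply, mul_one, lintegral_const, ENNReal.rpow_two, one_pow, one_mul] at h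
  calc _ ≤ ((∫⁻ x, f x ^ 2 ∂μ) ^ (1 / 2 : ℝ) * μ univ ^ (1 / 2 : ℝ)) ^ 2 := by gcongr
    _ = _ := by
      rw [mul_pow, ← ENNReal.rpow_natCast, ← ENNReal.rpow_natCast, ← ENNReal.rpow_mul,
        ← ENNReal.rpow_mul]
      norm_num
      rw [mul_comm]

/-- Local averages at scale `δ` map `L²` to `L⁴`, with norm `O(δ^{1/4})` after division
by `δ²`. -/
lemma lintegral_pow_four_le_of_local_bound {ν : Measure E3} [SFinite ν] (hν : ν ≤ volume)
    {f D : E3 → ENNReal} (hf : AEMeasurable f ν) {C δ : ℝ} (hδ : 0 < δ) (hC : 0 ≤ C)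
    (hD : ∀ᵐ x ∂ν, D x ≤ ENNReal.ofReal (C / δ ^ 2) * ∫⁻ z in closedBall x δ, f z ∂ν) :
    ∫⁻ x, D x ^ 4 ∂ν
      ≤ ENNReal.ofReal (C ^ 4 * δ) * volume (ball (0 : E3) 1) ^ 3 * (∫⁻ z, f z ^ 2 ∂ν) ^ 2 := by
  set V := volume (ball (0 : E3) 1) with hV
  have hball : ∀ x, ν (closedBall x δ) ≤ ENNReal.ofReal (δ ^ 3) * V := fun x => by
    refine (hν _).trans ?_
    rw [Measure.addHaar_closedBall _ _ hδ.le]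
    simp [hV]
  set W : E3 → ENNReal := fun x => ∫⁻ z in closedBall x δ, f z ^ 2 ∂ν with hW
  have hWle : ∀ x, W x ≤ ∫⁻ z, f z ^ 2 ∂ν := fun x => setLIntegral_le_lintegral _ _
  let S : Set (E3 × E3) := {q | dist q.2 q.1 ≤ δ}
  have hS : MeasurableSet S :=
    (isClosed_le (continuous_snd.dist continuous_fst) continuous_const).measurableSet
  have hWS : ∀ x, W x = ∫⁻ z, S.indicator (fun q => f q.2 ^ 2) (x, z) ∂ν := fun x => by
    rw [hW]
    simp only
    rw [← lintegral_indicator measurableSet_closedBall]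
    rfl
  have hSm : AEMeasurable (S.indicator fun q : E3 × E3 => f q.2 ^ 2) (ν.prod ν) :=
    ((hf.pow_const 2).comp_snd).indicator hS
  have hWm : AEMeasurable W ν := by
    rw [funext hWS]
    exact hSm.lintegral_prod_right'
  have hWint : ∫⁻ x, W x ∂ν ≤ ENNReal.ofReal (δ ^ 3) * V * ∫⁻ z, f z ^ 2 ∂ν := by
    simp only [hWS]
    rw [lintegral_lintegral_swap (f := fun x z => S.indicator (fun q => f q.2 ^ 2) (x, z)) hSm,
      ← lintegral_const_mul'' _ (hf.pow_const 2)]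
    refine lintegral_mono fun z => ?_
    have h2 : ∀ x, S.indicator (fun q => f q.2 ^ 2) (x, z)
        = (closedBall z δ).indicator (fun _ => f z ^ 2) x := fun x => by
      simp only [indicator, S, mem_ofPred_eq, mem_closedBall, dist_comm]
    simp only [h2]
    rw [lintegral_indicator measurableSet_closedBall, setLIntegral_const, mul_comm]
    gcongr
    exact hball z
  have hpt : ∀ᵐ x ∂ν, D x ^ 4 ≤ ENNReal.ofReal (C / δ ^ 2) ^ 4
      * ((ENNReal.ofReal (δ ^ 3) * V) ^ 2 * ((∫⁻ z, f z ^ 2 ∂ν) * W x)) := by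
    filter_upwards [hD] with x hx
    have h1 : (∫⁻ z in closedBall x δ, f z ∂ν) ^ 2 ≤ ENNReal.ofReal (δ ^ 3) * V * W x := by
      refine (sq_lintegral_le _ hf.restrict).trans ?_
      rw [Measure.restrict_apply_univ]
      gcongr
      exact hball x
    calc D x ^ 4 ≤ (ENNReal.ofReal (C / δ ^ 2) * ∫⁻ z in closedBall x δ, f z ∂ν) ^ 4 := by
          gcongr
      _ = ENNReal.ofReal (C / δ ^ 2) ^ 4 * ((∫⁻ z in closedBall x δ, f z ∂ν) ^ 2) ^ 2 := by
          ring
      _ ≤ ENNReal.ofReal (C / δ ^ 2) ^ 4 * (ENNReal.ofReal (δ ^ 3) * V * W x) ^ 2 := by gcongr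
      _ = ENNReal.ofReal (C / δ ^ 2) ^ 4
          * ((ENNReal.ofReal (δ ^ 3) * V) ^ 2 * (W x * W x)) := by ring
      _ ≤ _ := by
          gcongr
          exact hWle x
  have hc : ENNReal.ofReal (C ^ 4 * δ)
      = ENNReal.ofReal (C / δ ^ 2) ^ 4 * ENNReal.ofReal (δ ^ 3) ^ 3 := by
    rw [← ENNReal.ofReal_pow (by positivity), ← ENNReal.ofReal_pow (by positivity),
      ← ENNReal.ofReal_mul (by positivity)]
    congr 1
    field_simp
  calc _ ≤ ∫⁻ x, ENNReal.ofReal (C / δ ^ 2) ^ 4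
      * ((ENNReal.ofReal (δ ^ 3) * V) ^ 2 * ((∫⁻ z, f z ^ 2 ∂ν) * W x)) ∂ν := lintegral_mono_ae hpt
    _ = ENNReal.ofReal (C / δ ^ 2) ^ 4
      * ((ENNReal.ofReal (δ ^ 3) * V) ^ 2 * ((∫⁻ z, f z ^ 2 ∂ν) * ∫⁻ x, W x ∂ν)) := by
      rw [lintegral_const_mul'' _ ((hWm.const_mul _).const_mul _),
        lintegral_const_mul'' _ (hWm.const_mul _), lintegral_const_mul'' _ hWm]
    _ ≤ ENNReal.ofReal (C / δ ^ 2) ^ 4 * ((ENNReal.ofReal (δ ^ 3) * V) ^ 2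
      * ((∫⁻ z, f z ^ 2 ∂ν) * (ENNReal.ofReal (δ ^ 3) * V * ∫⁻ z, f z ^ 2 ∂ν))) := by gcongr
    _ = _ := by
      rw [hc]
      ring

lemma eLpNorm_natCast_pow {α F : Type*} [MeasurableSpace α] [NormedAddCommGroup F]
    {μ : Measure α} (f : α → F) {n : ℕ} (hn : n ≠ 0) :
    eLpNorm f (n : ENNReal) μ ^ n = ∫⁻ x, ‖f x‖ₑ ^ n ∂μ := by
  have h := eLpNorm_nnreal_pow_eq_lintegral (μ := μ) (f := f) (p := (n : NNReal))
    (by exact_mod_cast hn)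
  simpa using h

/-- The Sobolev inequality `W¹₂(B) ⊆ L₄(B)` in the unit ball. -/
theorem exists_eLpNorm_four_le :
    ∃ K : ENNReal, K ≠ ⊤ ∧ ∀ (u : E3 → ℝ) (g : Fin 3 → E3 → ℝ),
      MemLp u 2 (volume.restrict (ballB 1)) → (∀ j, MemLp (g j) 2 (volume.restrict (ballB 1))) →
      HasWeakGrad u g →
      eLpNorm u 4 (volume.restrict (ballB 1)) ≤ K * (eLpNorm u 2 (volume.restrict (ballB 1))
        + ∑ j, eLpNorm (g j) 2 (volume.restrict (ballB 1))) := by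
  obtain ⟨ψ, M, h⟩ := exists_isMollifier
  have hM := h.nonneg
  set ν : Measure E3 := volume.restrict (ballB 1) with hν
  have : IsFiniteMeasure ν := ⟨by
    rw [hν, Measure.restrict_apply_univ]; exact measure_ball_lt_top⟩
  set V := volume (ball (0 : E3) 1) with hVdef
  have hV : V ≠ ⊤ := measure_ball_lt_top.ne
  set A : ENNReal := ENNReal.ofReal M * ν univ ^ (1 / 2 : ℝ) * ν univ ^ (1 / 4 : ℝ) with hA
  set C₁ : ENNReal := ENNReal.ofReal (2 * (2048 * M)) * (V + 1) with hC₁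
  have hAtop : A ≠ ⊤ := by
    refine ENNReal.mul_ne_top (ENNReal.mul_ne_top ENNReal.ofReal_ne_top ?_) ?_ <;>
    exact ENNReal.rpow_ne_top_of_nonneg (by norm_num) (measure_ne_top ν _)
  have hC₁top : C₁ ≠ ⊤ :=
    ENNReal.mul_ne_top ENNReal.ofReal_ne_top (ENNReal.add_ne_top.mpr ⟨hV, ENNReal.one_ne_top⟩)
  refine ⟨A + C₁ * 2, ENNReal.add_ne_top.mpr
    ⟨hAtop, ENNReal.mul_ne_top hC₁top ENNReal.ofNat_ne_top⟩, fun u g hu hg hug => ?_⟩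
  set X := ∑ j, eLpNorm (g j) 2 ν with hX
  have hui : IntegrableOn u (ballB 1) := hu.integrable one_le_two
  have hgi : ∀ j, IntegrableOn (g j) (ballB 1) := fun j => (hg j).integrable one_le_two
  let G : E3 → ℝ := fun z => ∑ j, ‖g j z‖
  have hGm : AEStronglyMeasurable G ν := by
    have : ∀ j, AEStronglyMeasurable (fun z => ‖g j z‖) ν := fun j => (hg j).1.norm
    exact Finset.aestronglyMeasurable_fun_sum _ fun j _ => this j
  have hGX : eLpNorm G 2 ν ≤ X := by
    have h1 : G = ∑ j, fun z => ‖g j z‖ := by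
      ext z
      simp [G]
    rw [h1]
    exact (eLpNorm_sum_le (fun j _ => (hg j).1.norm) one_le_two).trans
      (Finset.sum_le_sum fun j _ => (eLpNorm_norm (g j)).le)
  have hmeas : ∀ l, AEStronglyMeasurable (coneAvg ψ u l) ν := by
    intro l
    have hψ := h.smooth.continuous
    have h1 : AEStronglyMeasurable
        (fun q : E3 × E3 => u q.2 * (l ^ 3 * ψ (q.1 + l • (q.2 - q.1)))) (ν.prod ν) :=
      hu.1.comp_snd.mul (Continuous.aestronglyMeasurable (by fun_prop))
    exact h1.integral_prod_right'
  have hbase : eLpNorm (coneAvg ψ u (16 ^ 0)) 4 ν ≤ A * eLpNorm u 2 ν := by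
    have h1 : ∀ x, ‖coneAvg ψ u (16 ^ 0) x‖ₑ ≤ ENNReal.ofReal M * eLpNorm u 1 ν := fun x => by
      rw [eLpNorm_one_eq_lintegral_enorm,
        ← lintegral_const_mul'' _ hu.1.enorm]
      refine (enorm_integral_le_lintegral_enorm _).trans (lintegral_mono fun z => ?_)
      simp only [pow_zero, one_pow, one_mul, enorm_mul]
      rw [mul_comm]
      gcongr
      rw [← ofReal_norm]
      exact ENNReal.ofReal_le_ofReal (h.bound _)
    refine (eLpNorm_le_of_ae_enorm_bound (Filter.Eventually.of_forall h1)).trans ?_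
    have h2 := eLpNorm_le_eLpNorm_mul_rpow_measure_univ (μ := ν) (p := 1) (q := 2)
      one_le_two hu.1
    simp only [ENNReal.toReal_one, ENNReal.toReal_ofNat] at h2 ⊢
    calc _ ≤ ENNReal.ofReal M * (eLpNorm u 2 ν * ν univ ^ ((1 : ℝ) / 1 - 1 / 2))
          * ν univ ^ (4⁻¹ : ℝ) := mul_le_mul' (mul_le_mul' le_rfl h2) le_rfl
      _ = _ := by
          rw [hA]
          norm_num
          ring
  have hstep : ∀ n : ℕ, eLpNorm (coneAvg ψ u (16 ^ (n + 1)) - coneAvg ψ u (16 ^ n)) 4 ν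
      ≤ C₁ * X * 2⁻¹ ^ n := by
    intro n
    set l : ℝ := 16 ^ n with hl
    have hl1 : 1 ≤ l := one_le_pow₀ (by norm_num)
    have hl0 : 0 < l := by linarith
    have hloc : ∀ᵐ x ∂ν, ‖(coneAvg ψ u (16 ^ (n + 1)) - coneAvg ψ u l) x‖ₑ
        ≤ ENNReal.ofReal (2048 * M / (2 / l) ^ 2) * ∫⁻ z in closedBall x (2 / l), ‖G z‖ₑ ∂ν := by
      filter_upwards [ae_restrict_mem (measurableSet_ballB 1)] with x hx
      have h1 := h.norm_coneAvg_sub_le hui hug hgi (mem_ballB.mp hx) hl1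
      rw [show (16 : ℝ) ^ (n + 1) = 16 * l by rw [hl, pow_succ]; ring, Pi.sub_apply,
        ← ofReal_norm]
      refine (ENNReal.ofReal_le_ofReal h1).trans ?_
      rw [ENNReal.ofReal_mul (by positivity), hν,
        Measure.restrict_restrict measurableSet_closedBall, inter_comm]
      refine mul_le_mul' (ENNReal.ofReal_le_ofReal (le_of_eq ?_)) ?_
      · field_simp
        ring
      · have h2 : (0 : ℝ) ≤ ∫ z in closedBall x (2 / l) ∩ ballB 1, ∑ j, ‖g j z‖ :=
          integral_nonneg fun z => Finset.sum_nonneg fun j _ => norm_nonneg _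
        rw [← Real.enorm_of_nonneg h2]
        exact enorm_integral_le_lintegral_enorm _
    have h2 := lintegral_pow_four_le_of_local_bound Measure.restrict_le_self hGm.enorm
      (by positivity : 0 < 2 / l) (by positivity : 0 ≤ 2048 * M) hloc
    rw [← eLpNorm_natCast_pow G two_ne_zero,
      ← eLpNorm_natCast_pow (coneAvg ψ u (16 ^ (n + 1)) - coneAvg ψ u l) four_ne_zero] at h2
    refine (ENNReal.pow_le_pow_left_iff four_ne_zero).mp (h2.trans ?_)
    have h3 : (2⁻¹ : ENNReal) ^ n = ENNReal.ofReal ((1 / 2) ^ n) := by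
      rw [ENNReal.ofReal_pow (by norm_num)]
      simp
    rw [mul_pow (C₁ * X), mul_pow C₁, h3, hC₁, mul_pow _ (V + 1),
      ← ENNReal.ofReal_pow (by positivity), ← ENNReal.ofReal_pow (by positivity)]
    have h4 : V ^ 3 ≤ (V + 1) ^ 4 :=
      (pow_le_pow_left' le_self_add 3).trans (pow_le_pow_right₀ le_add_self (by norm_num))
    have h5 : ENNReal.ofReal ((2048 * M) ^ 4 * (2 / l)) ≤
        ENNReal.ofReal ((2 * (2048 * M)) ^ 4) * ENNReal.ofReal (((1 / 2) ^ n) ^ 4) := by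
      rw [← ENNReal.ofReal_mul (by positivity)]
      refine ENNReal.ofReal_le_ofReal ?_
      have : ((1 / 2 : ℝ) ^ n) ^ 4 = 1 / l := by
        rw [← pow_mul, mul_comm, pow_mul, hl, ← one_div_pow]
        norm_num
      rw [this, mul_pow]
      have h6 : 0 ≤ (2048 * M) ^ 4 * (1 / l) := by positivity
      rw [show (2 : ℝ) / l = 2 * (1 / l) by ring]
      nlinarith
    calc _ ≤ ENNReal.ofReal ((2 * (2048 * M)) ^ 4) * ENNReal.ofReal (((1 / 2) ^ n) ^ 4)
          * (V + 1) ^ 4 * ((X ^ 2) ^ 2) := by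
          gcongr
          exact_mod_cast hGX
      _ = _ := by ring
  have hN : ∀ N : ℕ, eLpNorm (coneAvg ψ u (16 ^ N)) 4 ν ≤ A * eLpNorm u 2 ν + C₁ * X * 2 := by
    intro N
    have h1 : coneAvg ψ u (16 ^ N) = coneAvg ψ u (16 ^ 0)
        + ∑ n ∈ Finset.range N, (coneAvg ψ u (16 ^ (n + 1)) - coneAvg ψ u (16 ^ n)) := by
      rw [Finset.sum_range_sub (fun n => coneAvg ψ u (16 ^ n))]
      abel
    have h4 : (1 : ENNReal) ≤ 4 := by norm_num
    rw [h1]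
    refine (eLpNorm_add_le (hmeas _)
      (Finset.aestronglyMeasurable_sum _ fun n _ => (hmeas _).sub (hmeas _)) h4).trans ?_
    gcongr
    refine (eLpNorm_sum_le (fun n _ => (hmeas _).sub (hmeas _)) h4).trans ?_
    refine (Finset.sum_le_sum fun n _ => hstep n).trans ?_
    rw [← Finset.mul_sum]
    gcongr
    refine (ENNReal.sum_le_tsum _).trans (le_of_eq ?_)
    rw [ENNReal.tsum_geometric, ENNReal.one_sub_inv_two, inv_inv]
  have hlim := Lp.eLpNorm_lim_le_liminf_eLpNorm (p := 4) (fun n => hmeas (16 ^ n)) u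
    (h.tendsto_coneAvg hui)
  refine hlim.trans ((Filter.liminf_le_of_le (h := fun b hb => ?_)).trans
    (b := A * eLpNorm u 2 ν + C₁ * X * 2) ?_)
  · obtain ⟨n, hn⟩ := hb.exists
    exact hn.trans (hN n)
  · rw [mul_right_comm C₁, mul_add]
    exact add_le_add (mul_le_mul' le_self_add le_rfl) (mul_le_mul' le_add_self le_rfl)

lemma HasWeakGrad.integral_eq_zero_of_not_aestronglyMeasurable {u : E3 → ℝ} {g : Fin 3 → E3 → ℝ}
    (hug : HasWeakGrad u g) (hu : IntegrableOn u (ballB 1)) {j : Fin 3}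
    (hj : ¬ AEStronglyMeasurable (g j) (volume.restrict (ballB 1)))
    {φ : E3 → ℝ} (hφ : ContDiff ℝ (⊤ : ℕ∞) φ) (hs : tsupport φ ⊆ ballB 1) :
    ∫ x in ballB 1, u x * fderiv ℝ φ x (EuclideanSpace.single j (1 : ℝ)) = 0 := by
  obtain ⟨r, hr0, hr1, hr⟩ : ∃ r : ℝ, 0 < r ∧ r < 1 ∧
      ¬ AEStronglyMeasurable (g j) (volume.restrict (ballB r)) := by
    by_contra! hcon
    refine hj ?_
    have hU : ballB 1 = ⋃ n : ℕ, ballB (1 - 1 / (n + 2 : ℝ)) := by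
      ext x
      simp only [mem_iUnion, mem_ballB]
      constructor
      · intro hx
        obtain ⟨n, hn⟩ := exists_nat_one_div_lt (sub_pos.mpr hx)
        refine ⟨n, ?_⟩
        have : 1 / (n + 2 : ℝ) ≤ 1 / (n + 1) := by gcongr; norm_num
        linarith
      · rintro ⟨n, hn⟩
        have : 0 < 1 / (n + 2 : ℝ) := by positivity
        linarith
    rw [hU, aestronglyMeasurable_iUnion_iff]
    intro n
    have h1 : 0 < 1 / (n + 2 : ℝ) := by positivity
    have h2 : 1 / (n + 2 : ℝ) < 1 := by
      rw [div_lt_one (by positivity)]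
      linarith [(Nat.cast_nonneg n : (0 : ℝ) ≤ n)]
    exact hcon _ (by linarith) (by linarith)
  let b : ContDiffBump (0 : E3) := ⟨r, (1 + r) / 2, hr0, by linarith⟩
  have hb : ContDiff ℝ (⊤ : ℕ∞) b := b.contDiff
  have hbs : tsupport b ⊆ ballB 1 := by
    rw [b.tsupport_eq]
    exact closedBall_subset_ball (by simp only [b]; linarith)
  have hni : ¬ IntegrableOn (fun x => g j x * b x) (ballB 1) := by
    intro hi
    refine hr ((hi.aestronglyMeasurable.mono_measure
      (Measure.restrict_mono (ball_subset_ball hr1.le) le_rfl)).congr ?_)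
    filter_upwards [ae_restrict_mem (measurableSet_ballB r)] with x hx
    rw [b.one_of_mem_closedBall (ball_subset_closedBall hx), mul_one]
  have h0 : ∀ φ : E3 → ℝ, ContDiff ℝ (⊤ : ℕ∞) φ → tsupport φ ⊆ ballB 1 →
      ¬ IntegrableOn (fun x => g j x * φ x) (ballB 1) →
      ∫ x in ballB 1, u x * fderiv ℝ φ x (EuclideanSpace.single j (1 : ℝ)) = 0 := by
    intro φ hφ hs hi
    rw [hug φ hφ hs j, integral_undef hi, neg_zero]
  by_cases hi : IntegrableOn (fun x => g j x * φ x) (ballB 1)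
  · have h1 := h0 (fun x => φ x + b x) (hφ.add hb)
      ((tsupport_add φ b).trans (union_subset hs hbs)) (fun hc => hni (by
        refine (Integrable.sub hc hi).congr (Filter.Eventually.of_forall fun x => ?_)
        simp only [Pi.sub_apply]
        ring))
    have h2 : ∀ x, fderiv ℝ (fun x => φ x + b x) x (EuclideanSpace.single j (1 : ℝ))
        = fderiv ℝ φ x (EuclideanSpace.single j (1 : ℝ))
          + fderiv ℝ b x (EuclideanSpace.single j (1 : ℝ)) := fun x => by
      rw [fderiv_fun_add (hφ.differentiable (by simp) x) (hb.differentiable (by simp) x)]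
      rfl
    simp only [h2, mul_add] at h1
    rw [integral_add (integrableOn_mul_fderiv hu hφ hs _) (integrableOn_mul_fderiv hu hb hbs _),
      h0 b hb hbs hni, add_zero] at h1
    exact h1
  · exact h0 φ hφ hs hi

/-- A weak gradient may be replaced by a measurable one which is pointwise no larger. -/
lemma HasWeakGrad.exists_aestronglyMeasurable {u : E3 → ℝ} {g : Fin 3 → E3 → ℝ}
    (hug : HasWeakGrad u g) (hu : IntegrableOn u (ballB 1)) :
    ∃ g' : Fin 3 → E3 → ℝ, HasWeakGrad u g' ∧
      (∀ j, AEStronglyMeasurable (g' j) (volume.restrict (ballB 1))) ∧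
      ∀ j x, g' j x ^ 2 ≤ g j x ^ 2 := by
  classical
  refine ⟨fun j => if AEStronglyMeasurable (g j) (volume.restrict (ballB 1)) then g j else 0,
    fun φ hφ hs j => ?_, fun j => ?_, fun j x => ?_⟩
  · by_cases hj : AEStronglyMeasurable (g j) (volume.restrict (ballB 1))
    · simpa [hj] using hug φ hφ hs j
    · simpa [hj] using hug.integral_eq_zero_of_not_aestronglyMeasurable hu hj hφ hs
  · by_cases hj : AEStronglyMeasurable (g j) (volume.restrict (ballB 1))
    · simp [hj]
    · simpa [hj] using aestronglyMeasurable_zero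
  · by_cases hj : AEStronglyMeasurable (g j) (volume.restrict (ballB 1))
    · simp [hj]
    · simpa [hj] using sq_nonneg _

lemma ennreal_add_sq_le (a b : ENNReal) : (a + b) ^ 2 ≤ 2 * (a ^ 2 + b ^ 2) := by
  have h := ENNReal.rpow_add_le_mul_rpow_add_rpow a b one_le_two
  norm_num at h
  exact h

/-- Multiplicative embedding of `L₂ ∩ W¹₂` into `L₃` in the unit ball. -/
lemma exists_lintegral_pow_three_le :
    ∃ K : ENNReal, K ≠ ⊤ ∧ ∀ (u : E3 → ℝ) (g : Fin 3 → E3 → ℝ) (h : E3 → ℝ),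
      MemLp u 2 (volume.restrict (ballB 1)) → HasWeakGrad u g → IntegrableOn h (ballB 1) →
      (∀ j x, g j x ^ 2 ≤ h x) →
      ∫⁻ x in ballB 1, ‖u x‖ₑ ^ 3 ≤ K * eLpNorm u 2 (volume.restrict (ballB 1))
        * ((∫⁻ x in ballB 1, ‖u x‖ₑ ^ 2) + ∫⁻ x in ballB 1, ENNReal.ofReal (h x)) := by
  obtain ⟨K, hK, hSob⟩ := exists_eLpNorm_four_le
  refine ⟨K ^ 2 * 20, ENNReal.mul_ne_top (ENNReal.pow_ne_top hK) (by simp),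
    fun u g h hu hug hh hgh => ?_⟩
  obtain ⟨g', hug', hg'm, hg'⟩ := hug.exists_aestronglyMeasurable (hu.integrable one_le_two)
  set ν : Measure E3 := volume.restrict (ballB 1)
  set H := ∫⁻ x, ENNReal.ofReal (h x) ∂ν with hH
  have hg2 : ∀ j, MemLp (g' j) 2 ν := fun j => by
    rw [memLp_two_iff_integrable_sq (hg'm j)]
    refine Integrable.mono' hh ((hg'm j).pow 2) (Filter.Eventually.of_forall fun x => ?_)
    rw [Real.norm_of_nonneg (sq_nonneg _)]
    exact (hg' j x).trans (hgh j x)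
  have hgH : ∀ j, eLpNorm (g' j) 2 ν ^ 2 ≤ H := fun j => by
    have h1 := eLpNorm_natCast_pow (μ := ν) (g' j) two_ne_zero
    rw [Nat.cast_ofNat] at h1
    rw [h1]
    refine lintegral_mono fun x => ?_
    rw [← ofReal_norm, ← ENNReal.ofReal_pow (norm_nonneg _)]
    refine ENNReal.ofReal_le_ofReal ?_
    rw [Real.norm_eq_abs, sq_abs]
    exact (hg' j x).trans (hgh j x)
  have hu2 : eLpNorm u 2 ν ^ 2 = ∫⁻ x, ‖u x‖ₑ ^ 2 ∂ν := by
    have h1 := eLpNorm_natCast_pow (μ := ν) u two_ne_zero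
    rwa [Nat.cast_ofNat] at h1
  have hu4 : eLpNorm u 4 ν ^ 4 = ∫⁻ x, ‖u x‖ₑ ^ 4 ∂ν := by
    have h1 := eLpNorm_natCast_pow (μ := ν) u four_ne_zero
    rwa [Nat.cast_ofNat] at h1
  have hsq : eLpNorm u 4 ν ^ 2 ≤ K ^ 2 * 20 * ((∫⁻ x, ‖u x‖ₑ ^ 2 ∂ν) + H) := by
    have h1 := pow_le_pow_left' (hSob u g' hu hg2 hug') 2
    refine h1.trans ?_
    rw [mul_pow, mul_assoc]
    gcongr
    rw [Fin.sum_univ_three, ← hu2]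
    set a := eLpNorm u 2 ν
    have h2 := hgH 0
    have h3 := hgH 1
    have h4 := hgH 2
    set b := eLpNorm (g' 0) 2 ν
    set c := eLpNorm (g' 1) 2 ν
    set d := eLpNorm (g' 2) 2 ν
    calc (a + (b + c + d)) ^ 2 ≤ 2 * (a ^ 2 + 2 * (2 * (b ^ 2 + c ^ 2) + d ^ 2)) := by
          refine (ennreal_add_sq_le _ _).trans ?_
          gcongr
          refine (ennreal_add_sq_le _ _).trans ?_
          gcongr
          exact ennreal_add_sq_le _ _
      _ ≤ 2 * (a ^ 2 + 2 * (2 * (H + H) + H)) := by gcongr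
      _ ≤ 20 * (a ^ 2 + H) := by
          rw [show 2 * (a ^ 2 + 2 * (2 * (H + H) + H)) = 2 * a ^ 2 + 20 * H by ring, mul_add]
          gcongr
          norm_num
  have hHol : (∫⁻ x, ‖u x‖ₑ ^ 3 ∂ν) ^ 2
      ≤ (eLpNorm u 2 ν * eLpNorm u 4 ν ^ 2) ^ 2 := by
    have h1 := ENNReal.lintegral_mul_le_Lp_mul_Lq ν Real.HolderConjugate.two_two
      hu.1.enorm (hu.1.enorm.pow_const 2)
    simp only [Pi.mul_apply, ENNReal.rpow_two] at h1
    calc (∫⁻ x, ‖u x‖ₑ ^ 3 ∂ν) ^ 2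
        = (∫⁻ x, ‖u x‖ₑ * ‖u x‖ₑ ^ 2 ∂ν) ^ 2 := by
          congr 2
          ext x
          ring
      _ ≤ ((∫⁻ x, ‖u x‖ₑ ^ 2 ∂ν) ^ (1 / 2 : ℝ)
          * (∫⁻ x, (‖u x‖ₑ ^ 2) ^ 2 ∂ν) ^ (1 / 2 : ℝ)) ^ 2 := by gcongr
      _ = (∫⁻ x, ‖u x‖ₑ ^ 2 ∂ν) * ∫⁻ x, ‖u x‖ₑ ^ 4 ∂ν := by
          simp only [← pow_mul]
          rw [mul_pow, ← ENNReal.rpow_natCast, ← ENNReal.rpow_natCast, ← ENNReal.rpow_mul,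
            ← ENNReal.rpow_mul]
          norm_num
      _ = _ := by
          rw [← hu2, ← hu4]
          ring
  have hHol' := (ENNReal.pow_le_pow_left_iff two_ne_zero).mp hHol
  refine hHol'.trans ((mul_le_mul' le_rfl hsq).trans (le_of_eq ?_))
  ring

lemma volume_restrict_QSet (r : ℝ) : (volume : Measure (E3 × ℝ)).restrict (QSet r)
    = (volume.restrict (ballB r)).prod (volume.restrict (timeI r)) := by
  rw [QSet, Measure.volume_eq_prod, Measure.prod_restrict]

lemma ae_aestronglyMeasurable_slice {μ : Measure E3} {τ : Measure ℝ} [SFinite μ] [SFinite τ]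
    {f : E3 × ℝ → ℝ} (hf : AEStronglyMeasurable f (μ.prod τ)) :
    ∀ᵐ t ∂τ, AEStronglyMeasurable (fun x => f (x, t)) μ :=
  hf.prod_swap.prodMk_left

namespace VelocityClass

variable {v : E3 → ℝ → E3} {gv : E3 → ℝ → Fin 3 → Fin 3 → ℝ}

lemma aestronglyMeasurable_coord {ϱ : ℝ} (h : VelocityClass v gv ϱ) (i : Fin 3) :
    AEStronglyMeasurable (fun z : E3 × ℝ => v z.1 z.2 i) (volume.restrict (QSet ϱ)) :=
  (EuclideanSpace.proj i : E3 →L[ℝ] ℝ).continuous.comp_aestronglyMeasurable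
    h.v_meas.aestronglyMeasurable

lemma lintegral_pow_three_lt_top (h : VelocityClass v gv 1) (i : Fin 3) :
    ∫⁻ z in QSet 1, ‖v z.1 z.2 i‖ₑ ^ 3 < ⊤ := by
  obtain ⟨K, hK, hKu⟩ := exists_lintegral_pow_three_le
  obtain ⟨M, hM⟩ := h.v_Linfty
  have hm := h.aestronglyMeasurable_coord i
  have hF := h.v_L2.add h.grad_L2
  have hv2 := h.v_L2
  have hg2 := h.grad_L2
  unfold IntegrableOn at hF hv2 hg2
  rw [volume_restrict_QSet] at hm hF hv2 hg2 ⊢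
  set μ : Measure E3 := volume.restrict (ballB 1)
  set τ : Measure ℝ := volume.restrict (timeI 1)
  set F : E3 × ℝ → ℝ := (fun z => ‖v z.1 z.2‖ ^ 2) + fun z => ∑ i, ∑ j, gv z.1 z.2 i j ^ 2
    with hFdef
  have hslice : ∀ᵐ t ∂τ, ∫⁻ x, ‖v x t i‖ₑ ^ 3 ∂μ
      ≤ K * (1 + ENNReal.ofReal M) * 2 * ∫⁻ x, ENNReal.ofReal (F (x, t)) ∂μ := by
    filter_upwards [ae_aestronglyMeasurable_slice hm, hv2.prod_left_ae, hg2.prod_left_ae, hM,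
      h.isGrad] with t hmt hvt hgt hMt hgrad
    have hle : ∀ x, v x t i ^ 2 ≤ ‖v x t‖ ^ 2 := fun x => by
      rw [← sq_abs]
      exact pow_le_pow_left₀ (abs_nonneg _) (abs_coord_le _ _) 2
    have hu : MemLp (fun x => v x t i) 2 μ := by
      rw [memLp_two_iff_integrable_sq hmt]
      refine hvt.mono' (hmt.pow 2) (Filter.Eventually.of_forall fun x => ?_)
      rw [Real.norm_of_nonneg (sq_nonneg _)]
      exact hle x
    have hsq : ∀ x, ‖v x t i‖ₑ ^ 2 ≤ ENNReal.ofReal (‖v x t‖ ^ 2) := fun x => by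
      rw [← ofReal_norm, ← ENNReal.ofReal_pow (norm_nonneg _), Real.norm_eq_abs, sq_abs]
      exact ENNReal.ofReal_le_ofReal (hle x)
    have hgn : ∀ x, 0 ≤ ∑ i, ∑ j, gv x t i j ^ 2 := fun x =>
      Finset.sum_nonneg fun _ _ => Finset.sum_nonneg fun _ _ => sq_nonneg _
    refine (hKu (fun x => v x t i) (fun j x => gv x t i j)
      (fun x => ∑ i, ∑ j, gv x t i j ^ 2) hu (fun φ hφ hs j => hgrad φ hφ hs i j) hgt
      fun j x => ?_).trans ?_
    · exact (Finset.single_le_sum (f := fun j => gv x t i j ^ 2)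
        (fun _ _ => sq_nonneg _) (Finset.mem_univ j)).trans
        (Finset.single_le_sum (f := fun i => ∑ j, gv x t i j ^ 2)
        (fun _ _ => Finset.sum_nonneg fun _ _ => sq_nonneg _) (Finset.mem_univ i))
    · have h2 : eLpNorm (fun x => v x t i) 2 μ ≤ 1 + ENNReal.ofReal M := by
        have h1 := eLpNorm_natCast_pow (μ := μ) (fun x => v x t i) two_ne_zero
        rw [Nat.cast_ofNat] at h1
        have h3 : eLpNorm (fun x => v x t i) 2 μ ^ 2 ≤ ENNReal.ofReal M := by
          rw [h1]
          refine (lintegral_mono hsq).trans ?_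
          rw [← ofReal_integral_eq_lintegral_ofReal hvt
            (Filter.Eventually.of_forall fun x => sq_nonneg _)]
          exact ENNReal.ofReal_le_ofReal hMt
        rcases le_total (eLpNorm (fun x => v x t i) 2 μ) 1 with h4 | h4
        · exact h4.trans le_self_add
        · exact ((le_self_pow₀ h4 two_ne_zero).trans h3).trans le_add_self
      rw [mul_assoc (K * (1 + ENNReal.ofReal M)), two_mul]
      gcongr with x x
      · refine (hsq x).trans (ENNReal.ofReal_le_ofReal ?_)
        simpa [hFdef] using hgn x
      · simp [hFdef]
  rw [lintegral_prod_symm _ (hm.enorm.pow_const 3)]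
  refine (lintegral_mono_ae hslice).trans_lt ?_
  rw [lintegral_const_mul' _ _ (by finiteness)]
  rw [← lintegral_prod_symm _ hF.aestronglyMeasurable.aemeasurable.ennreal_ofReal]
  exact ENNReal.mul_lt_top (by finiteness) hF.lintegral_lt_top

lemma integrableOn_norm_pow_three (h : VelocityClass v gv 1) :
    IntegrableOn (fun z : E3 × ℝ => ‖v z.1 z.2‖ ^ 3) (QSet 1) := by
  have h1 : ∀ i, MemLp (fun z : E3 × ℝ => v z.1 z.2 i) 3 (volume.restrict (QSet 1)) := fun i => by
    refine ⟨h.aestronglyMeasurable_coord i, ?_⟩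
    have h2 := eLpNorm_natCast_pow (μ := volume.restrict (QSet 1))
      (fun z : E3 × ℝ => v z.1 z.2 i) three_ne_zero
    rw [Nat.cast_ofNat] at h2
    have h3 := h.lintegral_pow_three_lt_top i
    rw [← h2] at h3
    exact (ENNReal.pow_lt_top_iff.mp h3).resolve_right three_ne_zero
  have h2 : MemLp (fun z : E3 × ℝ => v z.1 z.2) 3 (volume.restrict (QSet 1)) := by
    have h3 : MemLp (fun z : E3 × ℝ => ∑ i, ‖v z.1 z.2 i‖) 3 (volume.restrict (QSet 1)) :=
      memLp_finsetSum Finset.univ fun i _ => (h1 i).norm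
    refine h3.of_le h.v_meas.aestronglyMeasurable (Filter.Eventually.of_forall fun z => ?_)
    rw [Real.norm_of_nonneg (Finset.sum_nonneg fun _ _ => norm_nonneg _)]
    conv_lhs => rw [eq_sum_single (v z.1 z.2)]
    refine (norm_sum_le _ _).trans (Finset.sum_le_sum fun i _ => ?_)
    rw [norm_smul, PiLp.norm_single, norm_one, mul_one]
  exact h2.integrable_norm_pow three_ne_zero

end VelocityClass

/-! ### Cut-off functions -/

lemma fderiv_mul_fst_snd {χ : E3 → ℝ} {θ : ℝ → ℝ} {z : E3 × ℝ} (hχ : DifferentiableAt ℝ χ z.1)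
    (hθ : DifferentiableAt ℝ θ z.2) (w : E3 × ℝ) :
    fderiv ℝ (fun z : E3 × ℝ => χ z.1 * θ z.2) z w
      = fderiv ℝ χ z.1 w.1 * θ z.2 + χ z.1 * (w.2 * deriv θ z.2) := by
  have h1 : HasFDerivAt (fun z : E3 × ℝ => χ z.1)
      ((fderiv ℝ χ z.1).comp (ContinuousLinearMap.fst ℝ E3 ℝ)) z :=
    hχ.hasFDerivAt.comp z hasFDerivAt_fst
  have h2 : HasFDerivAt (fun z : E3 × ℝ => θ z.2)
      ((fderiv ℝ θ z.2).comp (ContinuousLinearMap.snd ℝ E3 ℝ)) z :=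
    hθ.hasFDerivAt.comp z hasFDerivAt_snd
  rw [(h1.fun_mul h2).fderiv]
  simp only [_root_.add_apply, _root_.smul_apply,
    ContinuousLinearMap.comp_apply, ContinuousLinearMap.coe_fst', ContinuousLinearMap.coe_snd',
    smul_eq_mul, fderiv_eq_smul_deriv]
  ring

lemma contDiff_fderiv_apply {χ : E3 → ℝ} (hχ : ContDiff ℝ (⊤ : ℕ∞) χ) (e : E3) :
    ContDiff ℝ (⊤ : ℕ∞) (fun y => fderiv ℝ χ y e) :=
  (hχ.fderiv_right (by simp)).clm_apply contDiff_const

lemma fderiv_comp_inv_smul {χ : E3 → ℝ} (hχ : Differentiable ℝ χ) (R : ℝ) (x e : E3) :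
    fderiv ℝ (fun y => χ (R⁻¹ • y)) x e = R⁻¹ * fderiv ℝ χ (R⁻¹ • x) e := by
  have h1 : HasFDerivAt (fun y : E3 => R⁻¹ • y) (R⁻¹ • ContinuousLinearMap.id ℝ E3) x :=
    (ContinuousLinearMap.hasFDerivAt (R⁻¹ • ContinuousLinearMap.id ℝ E3))
  have h2 := (hχ (R⁻¹ • x)).hasFDerivAt.comp x h1
  rw [show (fun y => χ (R⁻¹ • y)) = χ ∘ fun y => R⁻¹ • y from rfl, h2.fderiv]
  simp

/-- Spatial and temporal cut-off functions at scale `R` with derivatives controlled by `M`. -/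
structure IsCutoff (χ : E3 → ℝ) (θ : ℝ → ℝ) (M R : ℝ) : Prop where
  smooth_space : ContDiff ℝ (⊤ : ℕ∞) χ
  smooth_time : ContDiff ℝ (⊤ : ℕ∞) θ
  space_nonneg : ∀ x, 0 ≤ χ x
  space_le_one : ∀ x, χ x ≤ 1
  time_nonneg : ∀ t, 0 ≤ θ t
  time_le_one : ∀ t, θ t ≤ 1
  space_eq_one : ∀ x, ‖x‖ < R / 2 → χ x = 1
  space_eq_zero : ∀ x, 3 / 4 * R < ‖x‖ → χ x = 0
  time_eq_one : ∀ t, |t| < R ^ 2 / 4 → θ t = 1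
  time_eq_zero : ∀ t, R ^ 2 / 2 < |t| → θ t = 0
  fderiv_space : ∀ x j, |fderiv ℝ χ x (EuclideanSpace.single j (1 : ℝ))| ≤ M / R
  fderiv_fderiv_space : ∀ x j, |fderiv ℝ (fun y => fderiv ℝ χ y (EuclideanSpace.single j (1 : ℝ))) x
    (EuclideanSpace.single j (1 : ℝ))| ≤ M / R ^ 2
  deriv_time : ∀ t, |deriv θ t| ≤ M / R ^ 2

lemma exists_isCutoff : ∃ M : ℝ, 0 < M ∧ ∀ R : ℝ, 0 < R → ∃ χ θ, IsCutoff χ θ M R := by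
  let χ : ContDiffBump (0 : E3) := ⟨1 / 2, 3 / 4, by norm_num, by norm_num⟩
  let θ : ContDiffBump (0 : ℝ) := ⟨1 / 4, 1 / 2, by norm_num, by norm_num⟩
  have hχ : ContDiff ℝ (⊤ : ℕ∞) χ := χ.contDiff
  have hθ : ContDiff ℝ (⊤ : ℕ∞) θ := θ.contDiff
  have hχc : HasCompactSupport χ := χ.hasCompactSupport
  have hθc : HasCompactSupport θ := θ.hasCompactSupport
  have hχ' : ∀ j : Fin 3, ContDiff ℝ (⊤ : ℕ∞)
      (fun y => fderiv ℝ χ y (EuclideanSpace.single j (1 : ℝ))) :=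
    fun j => contDiff_fderiv_apply hχ _
  have hχc' : ∀ j : Fin 3, HasCompactSupport
      (fun y => fderiv ℝ χ y (EuclideanSpace.single j (1 : ℝ))) := fun j => hχc.fderiv_apply ℝ _
  choose M₁ hM₁ using fun j => (hχc' j).exists_bound_of_continuous (hχ' j).continuous
  choose M₂ hM₂ using fun j : Fin 3 =>
    ((hχc' j).fderiv_apply ℝ (EuclideanSpace.single j (1 : ℝ))).exists_bound_of_continuous
      (contDiff_fderiv_apply (hχ' j) (EuclideanSpace.single j (1 : ℝ))).continuous
  obtain ⟨M₃, hM₃⟩ := hθc.deriv.exists_bound_of_continuous (hθ.continuous_deriv (by simp))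
  set M := 1 + ∑ j, |M₁ j| + ∑ j, |M₂ j| + |M₃| with hM
  have s1 : 0 ≤ ∑ j, |M₁ j| := Finset.sum_nonneg fun _ _ => abs_nonneg _
  have s2 : 0 ≤ ∑ j, |M₂ j| := Finset.sum_nonneg fun _ _ => abs_nonneg _
  have s3 := abs_nonneg M₃
  have hM1 : ∀ j, M₁ j ≤ M := fun j => by
    have := Finset.single_le_sum (f := fun j => |M₁ j|) (fun _ _ => abs_nonneg _)
      (Finset.mem_univ j)
    have := le_abs_self (M₁ j)
    linarith
  have hM2 : ∀ j, M₂ j ≤ M := fun j => by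
    have := Finset.single_le_sum (f := fun j => |M₂ j|) (fun _ _ => abs_nonneg _)
      (Finset.mem_univ j)
    have := le_abs_self (M₂ j)
    linarith
  have hM3 : M₃ ≤ M := by
    have := le_abs_self M₃
    linarith
  refine ⟨M, by linarith, fun R hR => ⟨fun x => χ (R⁻¹ • x), fun t => θ ((R ^ 2)⁻¹ * t), ?_⟩⟩
  have hRi : 0 < R⁻¹ := inv_pos.mpr hR
  have hR2 : 0 < (R ^ 2)⁻¹ := by positivity
  have hnorm : ∀ x : E3, ‖R⁻¹ • x‖ = ‖x‖ / R := fun x => by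
    rw [norm_smul, Real.norm_of_nonneg hRi.le, div_eq_inv_mul]
  have habs : ∀ t : ℝ, |(R ^ 2)⁻¹ * t| = |t| / R ^ 2 := fun t => by
    rw [abs_mul, abs_of_pos hR2, div_eq_inv_mul]
  have hfd : ∀ j : Fin 3, (fun y => fderiv ℝ (fun x => χ (R⁻¹ • x)) y
      (EuclideanSpace.single j (1 : ℝ)))
      = fun y => R⁻¹ * fderiv ℝ χ (R⁻¹ • y) (EuclideanSpace.single j (1 : ℝ)) := fun j => by
    ext y
    exact fderiv_comp_inv_smul (hχ.differentiable (by simp)) R y _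
  constructor
  · exact hχ.comp (contDiff_const_smul _)
  · exact hθ.comp (contDiff_const.mul contDiff_id)
  · exact fun x => χ.nonneg
  · exact fun x => χ.le_one
  · exact fun x => θ.nonneg
  · exact fun x => θ.le_one
  · intro x hx
    refine χ.one_of_mem_closedBall ?_
    rw [mem_closedBall_zero_iff, hnorm, div_le_iff₀ hR]
    simp only [χ]
    linarith
  · intro x hx
    refine χ.zero_of_le_dist ?_
    rw [dist_zero_right, hnorm, le_div_iff₀ hR]
    simp only [χ]
    linarith
  · intro t ht
    refine θ.one_of_mem_closedBall ?_
    rw [mem_closedBall_zero_iff, Real.norm_eq_abs, habs, div_le_iff₀ (by positivity)]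
    simp only [θ]
    linarith
  · intro t ht
    refine θ.zero_of_le_dist ?_
    rw [dist_zero_right, Real.norm_eq_abs, habs, le_div_iff₀ (by positivity)]
    simp only [θ]
    linarith
  · intro x j
    rw [fderiv_comp_inv_smul (hχ.differentiable (by simp)), abs_mul, abs_of_pos hRi,
      div_eq_inv_mul]
    exact mul_le_mul_of_nonneg_left ((hM₁ j _).trans (hM1 j)) hRi.le
  · intro x j
    have h1 : Differentiable ℝ (fun y => fderiv ℝ χ (R⁻¹ • y) (EuclideanSpace.single j (1 : ℝ))) :=
      ((hχ' j).comp (contDiff_const_smul R⁻¹)).differentiable (by simp)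
    rw [hfd, fderiv_const_mul (h1 x), _root_.smul_apply, smul_eq_mul,
      fderiv_comp_inv_smul (χ := fun y => fderiv ℝ χ y (EuclideanSpace.single j (1 : ℝ)))
        ((hχ' j).differentiable (by simp)), ← mul_assoc, abs_mul,
      show R⁻¹ * R⁻¹ = (R ^ 2)⁻¹ by rw [sq, mul_inv], abs_of_pos hR2, div_eq_inv_mul]
    exact mul_le_mul_of_nonneg_left ((hM₂ j _).trans (hM2 j)) hR2.le
  · intro t
    rw [deriv_comp_mul_left, smul_eq_mul, abs_mul, abs_of_pos hR2, div_eq_inv_mul]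
    exact mul_le_mul_of_nonneg_left ((hM₃ _).trans hM3) hR2.le

namespace IsCutoff

variable {χ : E3 → ℝ} {θ : ℝ → ℝ} {M R : ℝ}

lemma tsupport_space_subset (h : IsCutoff χ θ M R) : tsupport χ ⊆ closedBall 0 (3 / 4 * R) := by
  refine closure_minimal (fun x hx => ?_) isClosed_closedBall
  rw [mem_closedBall_zero_iff]
  by_contra! hc
  exact hx (h.space_eq_zero x hc)

lemma fderiv_space_eq_zero (h : IsCutoff χ θ M R) {x : E3} (hx : 3 / 4 * R < ‖x‖) (e : E3) :
    fderiv ℝ χ x e = 0 := by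
  rw [fderiv_of_notMem_tsupport (𝕜 := ℝ) fun hc => absurd (mem_closedBall_zero_iff.mp
    (h.tsupport_space_subset hc)) (not_le.mpr hx)]
  rfl

lemma fderiv_fderiv_space_eq_zero (h : IsCutoff χ θ M R) {x : E3} (hx : 3 / 4 * R < ‖x‖) (e : E3) :
    fderiv ℝ (fun y => fderiv ℝ χ y e) x e = 0 := by
  rw [fderiv_of_notMem_tsupport (𝕜 := ℝ) fun hc => absurd (mem_closedBall_zero_iff.mp
    (h.tsupport_space_subset (tsupport_fderiv_apply_subset ℝ e hc))) (not_le.mpr hx)]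
  rfl

lemma deriv_time_eq_zero (h : IsCutoff χ θ M R) {t : ℝ} (ht : R ^ 2 / 2 < |t|) :
    deriv θ t = 0 := by
  have h1 : θ =ᶠ[nhds t] fun _ => 0 := by
    filter_upwards [(isOpen_lt continuous_const continuous_abs).mem_nhds ht] with s hs
    exact h.time_eq_zero s hs
  rw [h1.deriv_eq, deriv_const]

lemma contDiff_mul (h : IsCutoff χ θ M R) :
    ContDiff ℝ (⊤ : ℕ∞) (fun z : E3 × ℝ => χ z.1 * θ z.2) :=
  (h.smooth_space.comp contDiff_fst).mul (h.smooth_time.comp contDiff_snd)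

lemma fderiv_spaceDir (h : IsCutoff χ θ M R) (z : E3 × ℝ) (j : Fin 3) :
    fderiv ℝ (fun z : E3 × ℝ => χ z.1 * θ z.2) z (spaceDir j)
      = fderiv ℝ χ z.1 (EuclideanSpace.single j (1 : ℝ)) * θ z.2 := by
  rw [fderiv_mul_fst_snd (h.smooth_space.differentiable (by simp) _)
    (h.smooth_time.differentiable (by simp) _)]
  simp [spaceDir]

lemma fderiv_timeDir (h : IsCutoff χ θ M R) (z : E3 × ℝ) :
    fderiv ℝ (fun z : E3 × ℝ => χ z.1 * θ z.2) z timeDir = χ z.1 * deriv θ z.2 := by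
  rw [fderiv_mul_fst_snd (h.smooth_space.differentiable (by simp) _)
    (h.smooth_time.differentiable (by simp) _)]
  simp [timeDir]

lemma lapSpace_eq (h : IsCutoff χ θ M R) (z : E3 × ℝ) :
    lapSpace (fun z : E3 × ℝ => χ z.1 * θ z.2) z
      = (∑ j, fderiv ℝ (fun y => fderiv ℝ χ y (EuclideanSpace.single j (1 : ℝ))) z.1
          (EuclideanSpace.single j (1 : ℝ))) * θ z.2 := by
  rw [lapSpace, Finset.sum_mul]
  refine Finset.sum_congr rfl fun j _ => ?_
  simp only [h.fderiv_spaceDir]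
  rw [fderiv_mul_fst_snd ((contDiff_fderiv_apply h.smooth_space _).differentiable (by simp) _)
    (h.smooth_time.differentiable (by simp) _)]
  simp [spaceDir]

lemma exists_isOpen_eq_zero (h : IsCutoff χ θ M R) (hR : 0 < R) (hR1 : R ≤ 1) :
    ∃ U : Set (E3 × ℝ), IsOpen U ∧ parabBdry ⊆ U ∧ ∀ z ∈ U, χ z.1 * θ z.2 = 0 := by
  refine ⟨{z | 3 / 4 * R < ‖z.1‖} ∪ {z | R ^ 2 / 2 < |z.2|},
    (isOpen_lt continuous_const continuous_fst.norm).union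
      (isOpen_lt continuous_const continuous_snd.abs), ?_, ?_⟩
  · rintro z (hz | hz)
    · left
      have := mem_sphere_zero_iff_norm.mp hz.1
      rw [mem_ofPred_eq, this]
      linarith
    · right
      have : z.2 = -1 := hz.2
      rw [mem_ofPred_eq, this]
      norm_num
      nlinarith
  · rintro z (hz | hz)
    · rw [h.space_eq_zero _ hz, zero_mul]
    · rw [h.time_eq_zero _ hz, mul_zero]

lemma abs_lapSpace_add_le (h : IsCutoff χ θ M R) (z : E3 × ℝ) :
    |lapSpace (fun z : E3 × ℝ => χ z.1 * θ z.2) z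
      + fderiv ℝ (fun z : E3 × ℝ => χ z.1 * θ z.2) z timeDir| ≤ 4 * M / R ^ 2 := by
  rw [h.lapSpace_eq, h.fderiv_timeDir, Fin.sum_univ_three]
  have h0 := h.fderiv_fderiv_space z.1 0
  have h1 := h.fderiv_fderiv_space z.1 1
  have h2 := h.fderiv_fderiv_space z.1 2
  have h3 := h.deriv_time z.2
  have h4 : 4 * M / R ^ 2 = (M / R ^ 2 + M / R ^ 2 + M / R ^ 2) * 1 + 1 * (M / R ^ 2) := by ring
  rw [h4]
  refine (abs_add_le _ _).trans (add_le_add ?_ ?_)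
  · rw [abs_mul, abs_of_nonneg (h.time_nonneg _)]
    refine mul_le_mul ((abs_add_le _ _).trans (add_le_add ((abs_add_le _ _).trans
      (add_le_add h0 h1)) h2)) (h.time_le_one _) (h.time_nonneg _) ?_
    linarith [abs_nonneg (deriv θ z.2)]
  · rw [abs_mul, abs_of_nonneg (h.space_nonneg _)]
    exact mul_le_mul (h.space_le_one _) h3 (abs_nonneg _) zero_le_one

lemma abs_sum_mul_fderiv_le (h : IsCutoff χ θ M R) (z : E3 × ℝ) (w : E3) :
    |∑ i, w i * fderiv ℝ (fun z : E3 × ℝ => χ z.1 * θ z.2) z (spaceDir i)|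
      ≤ 3 * M / R * ‖w‖ := by
  have h1 : ∀ i, |w i * fderiv ℝ (fun z : E3 × ℝ => χ z.1 * θ z.2) z (spaceDir i)|
      ≤ ‖w‖ * (M / R) := fun i => by
    rw [h.fderiv_spaceDir, abs_mul, abs_mul, abs_of_nonneg (h.time_nonneg _)]
    refine mul_le_mul (abs_coord_le _ _) ?_ (by have := h.time_nonneg z.2; positivity)
      (norm_nonneg _)
    exact (mul_le_of_le_one_right (abs_nonneg _) (h.time_le_one _)).trans (h.fderiv_space _ _)
  refine (Finset.abs_sum_le_sum_abs _ _).trans ((Finset.sum_le_sum fun i _ => h1 i).trans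
    (le_of_eq ?_))
  rw [Finset.sum_const, Finset.card_univ, Fintype.card_fin, nsmul_eq_mul]
  push_cast
  ring

lemma lapSpace_eq_zero (h : IsCutoff χ θ M R) {z : E3 × ℝ}
    (hz : 3 / 4 * R < ‖z.1‖ ∨ R ^ 2 / 2 < |z.2|) :
    lapSpace (fun z : E3 × ℝ => χ z.1 * θ z.2) z = 0 := by
  rw [h.lapSpace_eq]
  rcases hz with hz | hz
  · simp [h.fderiv_fderiv_space_eq_zero hz]
  · simp [h.time_eq_zero _ hz]

lemma fderiv_timeDir_eq_zero (h : IsCutoff χ θ M R) {z : E3 × ℝ}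
    (hz : 3 / 4 * R < ‖z.1‖ ∨ R ^ 2 / 2 < |z.2|) :
    fderiv ℝ (fun z : E3 × ℝ => χ z.1 * θ z.2) z timeDir = 0 := by
  rw [h.fderiv_timeDir]
  rcases hz with hz | hz
  · simp [h.space_eq_zero _ hz]
  · simp [h.deriv_time_eq_zero hz]

lemma fderiv_spaceDir_eq_zero (h : IsCutoff χ θ M R) {z : E3 × ℝ}
    (hz : 3 / 4 * R < ‖z.1‖ ∨ R ^ 2 / 2 < |z.2|) (j : Fin 3) :
    fderiv ℝ (fun z : E3 × ℝ => χ z.1 * θ z.2) z (spaceDir j) = 0 := by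
  rw [h.fderiv_spaceDir]
  rcases hz with hz | hz
  · simp [h.fderiv_space_eq_zero hz]
  · simp [h.time_eq_zero _ hz]

end IsCutoff

/-! ### Divergence-free time slices -/

instance (r : ℝ) : IsFiniteMeasure ((volume : Measure ℝ).restrict (timeI r)) :=
  ⟨by rw [Measure.restrict_apply_univ]; exact measure_Ioo_lt_top⟩

lemma timeI_one : timeI 1 = Ioo (-1) 0 := by
  rw [timeI, one_pow]

lemma integrableOn_sum_mul_fderiv {v : E3 → ℝ → E3} {gv : E3 → ℝ → Fin 3 → Fin 3 → ℝ}
    (h : VelocityClass v gv 1) {χ : E3 → ℝ} (hχ : ContDiff ℝ (⊤ : ℕ∞) χ)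
    (hs : tsupport χ ⊆ ballB 1) :
    IntegrableOn (fun z : E3 × ℝ => ∑ i, v z.1 z.2 i
      * fderiv ℝ χ z.1 (EuclideanSpace.single i (1 : ℝ))) (QSet 1) := by
  have hc : HasCompactSupport χ :=
    HasCompactSupport.of_support_subset_isCompact (isCompact_closedBall (0 : E3) 1)
      ((subset_tsupport _).trans (hs.trans ball_subset_closedBall))
  have : IsFiniteMeasure ((volume : Measure (E3 × ℝ)).restrict (QSet 1)) := by
    rw [volume_restrict_QSet]
    infer_instance
  refine integrable_finsetSum _ fun i _ => ?_
  have hcont := (contDiff_fderiv_apply hχ (EuclideanSpace.single i (1 : ℝ))).continuous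
  obtain ⟨M, hM⟩ := (hc.fderiv_apply ℝ (EuclideanSpace.single i (1 : ℝ))).exists_bound_of_continuous
    hcont
  refine Integrable.mul_bdd (c := M) ?_
    (hcont.comp continuous_fst).aestronglyMeasurable (Filter.Eventually.of_forall fun z => hM _)
  refine (memLp_one_iff_integrable.mp ?_)
  refine MemLp.mono_exponent (q := 2) ?_ one_le_two
  rw [memLp_two_iff_integrable_sq (h.aestronglyMeasurable_coord i)]
  refine h.v_L2.mono' ((h.aestronglyMeasurable_coord i).pow 2)
    (Filter.Eventually.of_forall fun z => ?_)
  rw [Real.norm_of_nonneg (sq_nonneg _), ← sq_abs]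
  exact pow_le_pow_left₀ (abs_nonneg _) (abs_coord_le _ _) 2

lemma ae_integral_sum_mul_fderiv_eq_zero {v : E3 → ℝ → E3} {gv : E3 → ℝ → Fin 3 → Fin 3 → ℝ}
    {p : E3 → ℝ → ℝ} (h : VelocityClass v gv 1) (hN : NSEDistrib v gv p) {χ : E3 → ℝ}
    (hχ : ContDiff ℝ (⊤ : ℕ∞) χ) (hs : tsupport χ ⊆ ballB 1) :
    ∀ᵐ t ∂(volume.restrict (timeI 1)),
      ∫ x in ballB 1, ∑ i, v x t i * fderiv ℝ χ x (EuclideanSpace.single i (1 : ℝ)) = 0 := by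
  have hint := integrableOn_sum_mul_fderiv h hχ hs
  have hint' := hint
  unfold IntegrableOn at hint'
  rw [volume_restrict_QSet] at hint'
  have hw : IntegrableOn (fun t => ∫ x in ballB 1, ∑ i, v x t i
      * fderiv ℝ χ x (EuclideanSpace.single i (1 : ℝ))) (timeI 1) := hint'.integral_prod_right
  refine (ae_restrict_iff' measurableSet_Ioo).mpr
    (IsOpen.ae_eq_zero_of_integral_contDiff_smul_eq_zero isOpen_Ioo hw.locallyIntegrableOn
      fun η hη _ hηs => ?_)
  have hq := hN.2 (fun z => χ z.1 * η z.2) ((hχ.comp contDiff_fst).mul (hη.comp contDiff_snd)) (by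
    refine (closure_minimal (t := tsupport χ ×ˢ tsupport η) (fun z hz => ?_)
      ((isClosed_tsupport _).prod (isClosed_tsupport _))).trans (prod_mono hs hηs)
    exact ⟨subset_tsupport _ (left_ne_zero_of_mul hz), subset_tsupport _ (right_ne_zero_of_mul hz)⟩)
  have h1 : ∀ z : E3 × ℝ, ∑ i, v z.1 z.2 i * fderiv ℝ (fun z => χ z.1 * η z.2) z (spaceDir i)
      = (∑ i, v z.1 z.2 i * fderiv ℝ χ z.1 (EuclideanSpace.single i (1 : ℝ))) * η z.2 := by
    intro z
    rw [Finset.sum_mul]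
    refine Finset.sum_congr rfl fun i _ => ?_
    rw [fderiv_mul_fst_snd (hχ.differentiable (by simp) _) (hη.differentiable (by simp) _)]
    simp [spaceDir, mul_assoc]
  simp only [h1] at hq
  obtain ⟨Mη, hMη⟩ := ‹HasCompactSupport η›.exists_bound_of_continuous hη.continuous
  have hprod := hint'.mul_bdd (hη.continuous.comp continuous_snd).aestronglyMeasurable
    (Filter.Eventually.of_forall fun z => hMη z.2)
  rw [volume_restrict_QSet] at hq
  simp only [Function.comp_apply] at hprod
  rw [integral_prod_symm _ hprod] at hq
  simp only [integral_mul_const] at hq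
  rw [← setIntegral_eq_integral_of_forall_compl_eq_zero (s := timeI 1) fun t ht => ?_, ← hq]
  · refine integral_congr_ae (Filter.Eventually.of_forall fun t => ?_)
    simp only [smul_eq_mul]
    ring
  · rw [image_eq_zero_of_notMem_tsupport fun hc => ht (hηs hc), zero_smul]

lemma integral_add_eq_left {α : Type*} [MeasurableSpace α] {μ : Measure α} {f g : α → ℝ}
    (hg : Integrable g μ) (hg0 : ∫ x, g x ∂μ = 0) : ∫ x, (f x + g x) ∂μ = ∫ x, f x ∂μ := by
  by_cases hf : Integrable f μ
  · rw [integral_add hf hg, hg0, add_zero]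
  · rw [integral_undef hf, integral_undef fun hc => hf ((hc.sub hg).congr
      (Filter.Eventually.of_forall fun x => by simp))]

/-! ### Integrability in parabolic cylinders -/

lemma QSet_subset {r : ℝ} (hr : 0 < r) (hr1 : r ≤ 1) : QSet r ⊆ QSet 1 :=
  prod_mono (ball_subset_ball hr1) (Ioo_subset_Ioo_left (by nlinarith))

instance (r : ℝ) : IsFiniteMeasure ((volume : Measure (E3 × ℝ)).restrict (QSet r)) := by
  rw [volume_restrict_QSet]
  infer_instance

lemma measureReal_QSet {r : ℝ} (hr : 0 < r) :
    ((volume : Measure (E3 × ℝ)).restrict (QSet r)).real univ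
      = r ^ 5 * (volume : Measure E3).real (ball 0 1) := by
  rw [measureReal_restrict_apply_univ, QSet, Measure.volume_eq_prod, measureReal_prod_prod]
  have h1 : (volume : Measure E3).real (ballB r) =
      r ^ 3 * (volume : Measure E3).real (ball 0 1) := by
    rw [measureReal_def, ballB, Measure.addHaar_ball _ _ hr.le, ENNReal.toReal_mul,
      ENNReal.toReal_ofReal (by positivity), finrank_euclideanSpace_fin, measureReal_def]
  have h2 : (volume : Measure ℝ).real (timeI r) = r ^ 2 := by
    rw [timeI, Real.volume_real_Ioo]
    simp [sq_nonneg]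
  rw [h1, h2]
  ring

lemma memLp_ofReal_iff {α : Type*} [MeasurableSpace α] {μ : Measure α} {f : α → ℝ} {p : ℝ}
    (hf : AEStronglyMeasurable f μ) (hp : 0 < p) :
    MemLp f (ENNReal.ofReal p) μ ↔ Integrable (fun x => |f x| ^ p) μ := by
  rw [← integrable_norm_rpow_iff hf (by simpa using hp) (by simp), ENNReal.toReal_ofReal hp.le]
  rfl

lemma abs_avgB_rpow_le {r : ℝ} (hr : 0 < r) {f : E3 → ℝ} {q : ℝ} (hq : 1 ≤ q)
    (hf : IntegrableOn f (ballB r)) (hfq : IntegrableOn (fun x => |f x| ^ q) (ballB r)) :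
    |avgB r f| ^ q ≤ avgB r fun x => |f x| ^ q := by
  have : NeZero ((volume : Measure E3).restrict (ballB r)) := ⟨by
    rw [Ne, Measure.restrict_eq_zero]
    exact (measure_ball_pos _ _ hr).ne'⟩
  have h1 := (convexOn_rpow hq).map_average_le (μ := volume.restrict (ballB r))
    (f := fun x => |f x|)
    (Real.continuous_rpow_const (by linarith)).continuousOn isClosed_Ici
    (Filter.Eventually.of_forall fun x => mem_Ici.mpr (abs_nonneg _)) hf.abs hfq
  refine le_trans (Real.rpow_le_rpow (abs_nonneg _) ?_ (by linarith)) h1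
  rw [avgB, average_eq, average_eq, smul_eq_mul, smul_eq_mul, abs_mul,
    abs_of_nonneg (inv_nonneg.mpr measureReal_nonneg)]
  exact mul_le_mul_of_nonneg_left abs_integral_le_integral_abs (inv_nonneg.mpr measureReal_nonneg)

lemma ae_integrable_slice {r : ℝ} {f : E3 × ℝ → ℝ} (hf : IntegrableOn f (QSet r)) :
    ∀ᵐ t ∂(volume.restrict (timeI r)), IntegrableOn (fun x => f (x, t)) (ballB r) := by
  unfold IntegrableOn at hf
  rw [volume_restrict_QSet] at hf
  exact hf.prod_left_ae

lemma memLp_sub_avgB {r q : ℝ} (hr : 0 < r) (hq : 1 ≤ q) {p : E3 → ℝ → ℝ}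
    (hp : MemLp (fun z : E3 × ℝ => p z.1 z.2) (ENNReal.ofReal q) (volume.restrict (QSet r))) :
    MemLp (fun z : E3 × ℝ => p z.1 z.2 - avgB r (fun y => p y z.2)) (ENNReal.ofReal q)
      (volume.restrict (QSet r)) := by
  refine hp.sub ?_
  have hpi : IntegrableOn (fun z : E3 × ℝ => p z.1 z.2) (QSet r) :=
    hp.integrable (by simpa using hq)
  have hpq : IntegrableOn (fun z : E3 × ℝ => |p z.1 z.2| ^ q) (QSet r) :=
    (memLp_ofReal_iff hp.1 (by linarith)).mp hp
  have hs1 := ae_integrable_slice hpi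
  have hs2 := ae_integrable_slice hpq
  unfold IntegrableOn at hpi hpq
  rw [volume_restrict_QSet] at hpi hpq ⊢
  have hm : AEStronglyMeasurable (fun t => avgB r fun y => p y t) (volume.restrict (timeI r)) := by
    simp only [avgB, average_eq, smul_eq_mul]
    exact hpi.integral_prod_right.aestronglyMeasurable.const_mul _
  have hb : Integrable (fun t => avgB r fun y => |p y t| ^ q) (volume.restrict (timeI r)) := by
    simp only [avgB, average_eq, smul_eq_mul]
    exact hpq.integral_prod_right.const_mul _
  refine MemLp.comp_snd (f := fun t => avgB r fun y => p y t) ?_ _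
  rw [memLp_ofReal_iff hm (by linarith)]
  refine hb.mono' ((Real.continuous_rpow_const (by linarith)).comp_aestronglyMeasurable
    (continuous_abs.comp_aestronglyMeasurable hm)) ?_
  filter_upwards [hs1, hs2] with t h1 h2
  rw [Real.norm_of_nonneg (by positivity)]
  exact abs_avgB_rpow_le hr hq h1 h2

lemma integral_sq_le_rpow {α : Type*} [MeasurableSpace α] {μ : Measure α} [IsFiniteMeasure μ]
    {f : α → ℝ} (hf : MemLp f 3 μ) (hf0 : ∀ x, 0 ≤ f x) :
    ∫ x, f x ^ 2 ∂μ ≤ (∫ x, f x ^ 3 ∂μ) ^ (2 / 3 : ℝ) * (μ.real univ) ^ (1 / 3 : ℝ) := by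
  have hc : Real.HolderConjugate (3 / 2) 3 := by
    rw [Real.holderConjugate_iff]
    norm_num
  have h1 := integral_mul_le_Lp_mul_Lq_of_nonneg hc (μ := μ) (f := fun x => f x ^ 2)
    (g := fun _ => 1) (Filter.Eventually.of_forall fun x => sq_nonneg _)
    (Filter.Eventually.of_forall fun x => zero_le_one) ?_ (memLp_const _)
  · have h2 : ∀ x, (f x ^ 2) ^ (3 / 2 : ℝ) = f x ^ 3 := fun x => by
      rw [← Real.rpow_natCast, ← Real.rpow_mul (hf0 x), ← Real.rpow_natCast]
      norm_num
    simp only [mul_one, h2, Real.one_rpow, integral_const, smul_eq_mul] at h1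
    norm_num at h1 ⊢
    exact h1
  · rw [memLp_ofReal_iff (f := fun x => f x ^ 2) (hf.1.pow 2) (by norm_num)]
    refine (hf.integrable_norm_pow three_ne_zero).congr (Filter.Eventually.of_forall fun x => ?_)
    simp only [Real.norm_of_nonneg (hf0 x)]
    rw [abs_of_nonneg (sq_nonneg _), ← Real.rpow_natCast, ← Real.rpow_natCast,
      ← Real.rpow_mul (hf0 x)]
    norm_num

lemma integral_mul_le_rpow {α : Type*} [MeasurableSpace α] {μ : Measure α}
    {f g : α → ℝ} (hf : MemLp f 3 μ) (hf0 : ∀ x, 0 ≤ f x)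
    (hg : MemLp g (ENNReal.ofReal (3 / 2)) μ) (hg0 : ∀ x, 0 ≤ g x) :
    ∫ x, f x * g x ∂μ
      ≤ (∫ x, f x ^ 3 ∂μ) ^ (1 / 3 : ℝ) * (∫ x, g x ^ (3 / 2 : ℝ) ∂μ) ^ (2 / 3 : ℝ) := by
  have hc : Real.HolderConjugate 3 (3 / 2) := by
    rw [Real.holderConjugate_iff]
    norm_num
  have h1 := integral_mul_le_Lp_mul_Lq_of_nonneg hc (μ := μ)
    (Filter.Eventually.of_forall hf0) (Filter.Eventually.of_forall hg0) (by simpa using hf) hg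
  norm_num at h1 ⊢
  exact h1

/-! ### Estimate of the right-hand side of the local energy inequality -/

lemma setIntegral_QSet {r : ℝ} {f : E3 × ℝ → ℝ} (hf : IntegrableOn f (QSet r)) :
    ∫ z in QSet r, f z = ∫ t in timeI r, ∫ x in ballB r, f (x, t) := by
  unfold IntegrableOn at hf
  rw [volume_restrict_QSet] at hf ⊢
  exact integral_prod_symm _ hf

lemma VelocityClass.memLp_norm {v : E3 → ℝ → E3} {gv : E3 → ℝ → Fin 3 → Fin 3 → ℝ}
    (h : VelocityClass v gv 1) {R : ℝ} (hR : 0 < R) (hR1 : R ≤ 1) :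
    MemLp (fun z : E3 × ℝ => ‖v z.1 z.2‖) 3 (volume.restrict (QSet R)) := by
  have h1 : MemLp (fun z : E3 × ℝ => ‖v z.1 z.2‖) (ENNReal.ofReal 3)
      (volume.restrict (QSet 1)) := by
    rw [memLp_ofReal_iff h.v_meas.aestronglyMeasurable.norm (by norm_num)]
    refine h.integrableOn_norm_pow_three.congr (Filter.Eventually.of_forall fun z => ?_)
    simp only [abs_norm]
    norm_cast
  exact (by simpa using h1 : MemLp _ 3 _).mono_measure
    (Measure.restrict_mono (QSet_subset hR hR1) le_rfl)

/-- Pointwise majorant of the integrand on the right-hand side of the local energy inequality. -/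
def energyMajorant (v : E3 → ℝ → E3) (p : E3 → ℝ → ℝ) (M R : ℝ) (z : E3 × ℝ) : ℝ :=
  4 * M / R ^ 2 * ‖v z.1 z.2‖ ^ 2 + 3 * M / R * ‖v z.1 z.2‖ ^ 3
    + 6 * M / R * (‖v z.1 z.2‖ * |p z.1 z.2 - avgB R (fun y => p y z.2)|)

lemma rpow_parabolic_scaling {R : ℝ} (hR : 0 < R) {b C D : ℝ} (hb : 0 ≤ b) (hC : 0 ≤ C) (hD : 0 ≤ D) :
    (R ^ 2 * C) ^ (2 / 3 : ℝ) * (R ^ 5 * b) ^ (1 / 3 : ℝ)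
      = R ^ 3 * (C ^ (2 / 3 : ℝ) * b ^ (1 / 3 : ℝ))
    ∧ (R ^ 2 * C) ^ (1 / 3 : ℝ) * (R ^ 2 * D) ^ (2 / 3 : ℝ)
      = R ^ 2 * (C ^ (1 / 3 : ℝ) * D ^ (2 / 3 : ℝ)) := by
  have h1 : (R ^ 2) ^ (2 / 3 : ℝ) * (R ^ 5) ^ (1 / 3 : ℝ) = R ^ 3 := by
    rw [← Real.rpow_natCast, ← Real.rpow_natCast, ← Real.rpow_natCast, ← Real.rpow_mul hR.le,
      ← Real.rpow_mul hR.le, ← Real.rpow_add hR]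
    norm_num
  have h2 : (R ^ 2) ^ (1 / 3 : ℝ) * (R ^ 2) ^ (2 / 3 : ℝ) = R ^ 2 := by
    rw [← Real.rpow_add (by positivity)]
    norm_num
  constructor
  · rw [Real.mul_rpow (by positivity) hC, Real.mul_rpow (by positivity) hb, ← h1]
    ring
  · rw [Real.mul_rpow (by positivity) hC, Real.mul_rpow (by positivity) hD, mul_mul_mul_comm, h2]

namespace SuitableWeakSolution

variable {v : E3 → ℝ → E3} {gv : E3 → ℝ → Fin 3 → Fin 3 → ℝ} {p : E3 → ℝ → ℝ}

lemma memLp_pressure (h : SuitableWeakSolution v gv p) {R : ℝ} (hR : 0 < R) (hR1 : R ≤ 1) :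
    MemLp (fun z : E3 × ℝ => |p z.1 z.2 - avgB R (fun y => p y z.2)|) (ENNReal.ofReal (3 / 2))
      (volume.restrict (QSet R)) :=
  (memLp_sub_avgB hR (by norm_num) (((memLp_ofReal_iff h.p_meas.aestronglyMeasurable
    (by norm_num)).mpr h.p_L32).mono_measure
    (Measure.restrict_mono (QSet_subset hR hR1) le_rfl))).norm

lemma integrableOn_norm_mul_pressure (h : SuitableWeakSolution v gv p) {R : ℝ} (hR : 0 < R)
    (hR1 : R ≤ 1) : IntegrableOn (fun z : E3 × ℝ =>
      ‖v z.1 z.2‖ * |p z.1 z.2 - avgB R (fun y => p y z.2)|) (QSet R) := by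
  have hV := h.vel.memLp_norm hR hR1
  have hc : ENNReal.HolderConjugate (ENNReal.ofReal 3) (ENNReal.ofReal (3 / 2)) :=
    Real.HolderConjugate.ennrealOfReal (by rw [Real.holderConjugate_iff]; norm_num)
  exact MemLp.integrable_mul (p := ENNReal.ofReal 3) (by simpa using hV) (h.memLp_pressure hR hR1)

lemma integrableOn_energyMajorant (h : SuitableWeakSolution v gv p) (M : ℝ) {R : ℝ} (hR : 0 < R)
    (hR1 : R ≤ 1) : IntegrableOn (energyMajorant v p M R) (QSet R) := by
  have hV2 : IntegrableOn (fun z : E3 × ℝ => ‖v z.1 z.2‖ ^ 2) (QSet R) :=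
    h.vel.v_L2.mono_set (QSet_subset hR hR1)
  have hV3 : IntegrableOn (fun z : E3 × ℝ => ‖v z.1 z.2‖ ^ 3) (QSet R) :=
    h.vel.integrableOn_norm_pow_three.mono_set (QSet_subset hR hR1)
  have hVP := h.integrableOn_norm_mul_pressure hR hR1
  exact ((hV2.const_mul _).add (hV3.const_mul _)).add (hVP.const_mul _)

lemma integral_energyMajorant_le (h : SuitableWeakSolution v gv p) {M : ℝ} (hM : 0 ≤ M) {R : ℝ}
    (hR : 0 < R) (hR1 : R ≤ 1) :
    ∫ z in QSet R, energyMajorant v p M R z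
      ≤ 6 * M * (1 + (volume : Measure E3).real (ball 0 1) ^ (1 / 3 : ℝ)) * R
        * (funC v R ^ ((2 : ℝ) / 3) + funC v R
          + funC v R ^ ((1 : ℝ) / 3) * funD0 p R ^ ((2 : ℝ) / 3)) := by
  have hV := h.vel.memLp_norm hR hR1
  have hP := h.memLp_pressure hR hR1
  have hV2 : IntegrableOn (fun z : E3 × ℝ => ‖v z.1 z.2‖ ^ 2) (QSet R) :=
    h.vel.v_L2.mono_set (QSet_subset hR hR1)
  have hV3 : IntegrableOn (fun z : E3 × ℝ => ‖v z.1 z.2‖ ^ 3) (QSet R) :=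
    h.vel.integrableOn_norm_pow_three.mono_set (QSet_subset hR hR1)
  have hVP := h.integrableOn_norm_mul_pressure hR hR1
  have hP32 : IntegrableOn (fun z : E3 × ℝ =>
      |p z.1 z.2 - avgB R (fun y => p y z.2)| ^ (3 / 2 : ℝ)) (QSet R) := by
    have := (memLp_ofReal_iff hP.1 (by norm_num)).mp hP
    simp only [abs_abs] at this
    exact this
  have hC : ∫ z in QSet R, ‖v z.1 z.2‖ ^ 3 = R ^ 2 * funC v R := by
    rw [setIntegral_QSet hV3, funC, ← mul_assoc, mul_one_div_cancel (by positivity), one_mul]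
  have hD : ∫ z in QSet R, |p z.1 z.2 - avgB R (fun y => p y z.2)| ^ (3 / 2 : ℝ)
      = R ^ 2 * funD0 p R := by
    rw [setIntegral_QSet hP32, funD0, ← mul_assoc, mul_one_div_cancel (by positivity), one_mul]
  have hC0 : 0 ≤ funC v R :=
    mul_nonneg (by positivity) (integral_nonneg fun t => integral_nonneg fun x => by positivity)
  have hD0 : 0 ≤ funD0 p R :=
    mul_nonneg (by positivity) (integral_nonneg fun t => integral_nonneg fun x => by positivity)
  have h1 := integral_sq_le_rpow hV fun z => norm_nonneg _
  have h2 := integral_mul_le_rpow hV (fun z => norm_nonneg _) hP (fun z => abs_nonneg _)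
  set b := (volume : Measure E3).real (ball 0 1) with hb
  have hb0 : 0 ≤ b := measureReal_nonneg
  obtain ⟨h3, h4⟩ := rpow_parabolic_scaling hR hb0 hC0 hD0
  rw [hC, measureReal_QSet hR, h3] at h1
  rw [hC, hD, h4] at h2
  have hsplit : ∫ z in QSet R, energyMajorant v p M R z
      = 4 * M / R ^ 2 * (∫ z in QSet R, ‖v z.1 z.2‖ ^ 2) + 3 * M / R * (R ^ 2 * funC v R)
        + 6 * M / R * ∫ z in QSet R, ‖v z.1 z.2‖ * |p z.1 z.2 - avgB R (fun y => p y z.2)| := by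
    unfold energyMajorant
    rw [← hC, ← integral_const_mul, ← integral_const_mul, ← integral_const_mul,
      integral_add ?_ (hVP.const_mul _), integral_add (hV2.const_mul _) (hV3.const_mul _)]
    exact (hV2.const_mul _).add (hV3.const_mul _)
  rw [hsplit]
  set X := funC v R ^ (2 / 3 : ℝ)
  set Y := funC v R ^ (1 / 3 : ℝ) * funD0 p R ^ (2 / 3 : ℝ)
  set B := b ^ (1 / 3 : ℝ)
  have hX : 0 ≤ X := by positivity
  have hY : 0 ≤ Y := by positivity
  have hB : 0 ≤ B := by positivity
  calc _ ≤ 4 * M / R ^ 2 * (R ^ 3 * (X * B)) + 3 * M / R * (R ^ 2 * funC v R)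
        + 6 * M / R * (R ^ 2 * Y) := by gcongr
    _ = M * R * (4 * X * B + 3 * funC v R + 6 * Y) := by
        field_simp
    _ ≤ M * R * (6 * (1 + B) * (X + funC v R + Y)) := by
        gcongr
        nlinarith [mul_nonneg hX hB, mul_nonneg hC0 hB, mul_nonneg hY hB]
    _ = _ := by ring

end SuitableWeakSolution

/-- The integrand on the right-hand side of the local energy inequality. -/
def energyRhs (v : E3 → ℝ → E3) (p : E3 → ℝ → ℝ) (φ : E3 × ℝ → ℝ) (x : E3) (s : ℝ) : ℝ :=
  ‖v x s‖ ^ 2 * (lapSpace φ (x, s) + fderiv ℝ φ (x, s) timeDir)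
    + (∑ i, v x s i * fderiv ℝ φ (x, s) (spaceDir i)) * (‖v x s‖ ^ 2 + 2 * p x s)

namespace IsCutoff

variable {χ : E3 → ℝ} {θ : ℝ → ℝ} {M R : ℝ}

lemma energyRhs_eq_zero (h : IsCutoff χ θ M R) (v : E3 → ℝ → E3) (p : E3 → ℝ → ℝ) {x : E3} {s : ℝ}
    (hz : 3 / 4 * R < ‖x‖ ∨ R ^ 2 / 2 < |s|) :
    energyRhs v p (fun z : E3 × ℝ => χ z.1 * θ z.2) x s = 0 := by
  simp [energyRhs, h.lapSpace_eq_zero (z := (x, s)) hz, h.fderiv_timeDir_eq_zero (z := (x, s)) hz,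
    h.fderiv_spaceDir_eq_zero (z := (x, s)) hz]

lemma abs_energyRhs_le (h : IsCutoff χ θ M R) (v : E3 → ℝ → E3) (p : E3 → ℝ → ℝ) (x : E3) (s : ℝ) :
    |energyRhs v (fun x s => p x s - avgB R fun y => p y s)
      (fun z : E3 × ℝ => χ z.1 * θ z.2) x s| ≤ energyMajorant v p M R (x, s) := by
  have h1 := h.abs_lapSpace_add_le (x, s)
  have h2 := h.abs_sum_mul_fderiv_le (x, s) (v x s)
  set P := p x s - avgB R fun y => p y s with hP
  have h3 : |‖v x s‖ ^ 2 + 2 * P| ≤ ‖v x s‖ ^ 2 + 2 * |P| := by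
    refine (abs_add_le _ _).trans (le_of_eq ?_)
    rw [abs_mul, abs_two, abs_of_nonneg (sq_nonneg _)]
  have h4 : 0 ≤ 3 * M / R * ‖v x s‖ := (abs_nonneg _).trans h2
  calc _ ≤ ‖v x s‖ ^ 2 * (4 * M / R ^ 2)
        + 3 * M / R * ‖v x s‖ * (‖v x s‖ ^ 2 + 2 * |P|) := by
        refine (abs_add_le _ _).trans (add_le_add ?_ ?_)
        · rw [abs_mul, abs_of_nonneg (sq_nonneg _)]
          exact mul_le_mul_of_nonneg_left h1 (sq_nonneg _)
        · rw [abs_mul]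
          exact mul_le_mul h2 h3 (abs_nonneg _) h4
    _ = _ := by
        simp only [energyMajorant, ← hP]
        ring

end IsCutoff

namespace SuitableWeakSolution

variable {v : E3 → ℝ → E3} {gv : E3 → ℝ → Fin 3 → Fin 3 → ℝ} {p : E3 → ℝ → ℝ}
  {χ : E3 → ℝ} {θ : ℝ → ℝ} {M R : ℝ}

/-- The pressure may be normalised since time slices of `v` are divergence free. -/
lemma ae_integral_energyRhs_sub (h : SuitableWeakSolution v gv p) (hc : IsCutoff χ θ M R)
    (hR1 : R ≤ 1) (m : ℝ → ℝ) :
    ∀ᵐ s ∂(volume.restrict (timeI 1)),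
      ∫ x in ballB 1, energyRhs v p (fun z : E3 × ℝ => χ z.1 * θ z.2) x s
        = ∫ x in ballB 1, energyRhs v (fun x s => p x s - m s)
          (fun z : E3 × ℝ => χ z.1 * θ z.2) x s := by
  have hs : tsupport χ ⊆ ballB 1 :=
    hc.tsupport_space_subset.trans (closedBall_subset_ball (by linarith))
  filter_upwards [ae_integral_sum_mul_fderiv_eq_zero h.vel h.nse hc.smooth_space hs,
    ae_integrable_slice (integrableOn_sum_mul_fderiv h.vel hc.smooth_space hs)] with s h0 hi
  have h1 := integral_add_eq_left (f := fun x => energyRhs v (fun x s => p x s - m s)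
    (fun z : E3 × ℝ => χ z.1 * θ z.2) x s) (hi.mul_const (θ s * 2 * m s)) (by
      rw [integral_mul_const, h0, zero_mul])
  rw [← h1]
  refine integral_congr_ae (Filter.Eventually.of_forall fun x => ?_)
  simp only [energyRhs, hc.fderiv_spaceDir, ← mul_assoc, ← Finset.sum_mul]
  ring

lemma ae_abs_integral_energyRhs_le (h : SuitableWeakSolution v gv p) (hc : IsCutoff χ θ M R)
    (hR : 0 < R) (hR1 : R ≤ 1) :
    ∀ᵐ s ∂(volume.restrict (timeI 1)),
      |∫ x in ballB 1, energyRhs v p (fun z : E3 × ℝ => χ z.1 * θ z.2) x s|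
        ≤ (timeI R).indicator (fun s => ∫ x in ballB R, energyMajorant v p M R (x, s)) s := by
  have hi : ∀ᵐ s ∂(volume.restrict (timeI 1)), s ∈ timeI R →
      IntegrableOn (fun x => energyMajorant v p M R (x, s)) (ballB R) :=
    ae_restrict_of_ae ((ae_restrict_iff' measurableSet_Ioo).mp
      (ae_integrable_slice (h.integrableOn_energyMajorant M hR hR1)))
  filter_upwards [h.ae_integral_energyRhs_sub hc hR1 (fun s => avgB R fun y => p y s), hi,
    ae_restrict_mem measurableSet_Ioo] with s h1 h2 h3
  by_cases hs : s ∈ timeI R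
  · rw [indicator_of_mem hs, h1, setIntegral_eq_of_subset_of_forall_sdiff_eq_zero
      (measurableSet_ballB 1) (ball_subset_ball hR1 : ballB R ⊆ ballB 1) fun x hx => ?_]
    · rw [← Real.norm_eq_abs]
      refine norm_integral_le_of_norm_le (h2 hs) (Filter.Eventually.of_forall fun x => ?_)
      exact hc.abs_energyRhs_le v p x s
    · refine hc.energyRhs_eq_zero _ _ (Or.inl ?_)
      have := not_lt.mp fun hc => hx.2 (mem_ballB.mpr hc)
      linarith
  · have h4 : R ^ 2 / 2 < |s| := by
      have h5 : s ≤ -R ^ 2 := not_lt.mp fun hc => hs ⟨hc, h3.2⟩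
      rw [abs_of_neg h3.2]
      have : 0 < R ^ 2 := by positivity
      linarith
    rw [indicator_of_notMem hs]
    simp [hc.energyRhs_eq_zero v p (Or.inr h4)]

lemma ae_energy_le (h : SuitableWeakSolution v gv p) (hc : IsCutoff χ θ M R) (hM : 0 ≤ M)
    (hR : 0 < R) (hR1 : R ≤ 1) :
    ∀ᵐ t ∂(volume.restrict (timeI 1)),
      (∫ x in ballB 1, χ x * θ t * ‖v x t‖ ^ 2)
        + 2 * ∫ s in Ioo (-1 : ℝ) t, ∫ x in ballB 1, χ x * θ s * ∑ i, ∑ j, (gv x s i j) ^ 2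
      ≤ ∫ z in QSet R, energyMajorant v p M R z := by
  have hlei := h.lei
  unfold LocalEnergyIneq at hlei
  rw [← timeI_one] at hlei
  have hmaj := h.integrableOn_energyMajorant M hR hR1
  have hB : IntegrableOn (fun s => ∫ x in ballB R, energyMajorant v p M R (x, s)) (timeI R) := by
    have h1 := hmaj
    unfold IntegrableOn at h1
    rw [volume_restrict_QSet] at h1
    exact h1.integral_prod_right
  have hsub : timeI R ⊆ timeI 1 := Ioo_subset_Ioo_left (by nlinarith)
  have hind : Integrable ((timeI R).indicator
      (fun s => ∫ x in ballB R, energyMajorant v p M R (x, s))) :=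
    (integrable_indicator_iff measurableSet_Ioo).mpr hB
  have hind0 : ∀ s, 0 ≤ (timeI R).indicator
      (fun s => ∫ x in ballB R, energyMajorant v p M R (x, s)) s := fun s =>
    indicator_nonneg (fun s _ => integral_nonneg fun x => by
      unfold energyMajorant
      positivity) s
  filter_upwards [hlei, ae_restrict_mem measurableSet_Ioo] with t ht htm
  have h1 := ht _ hc.contDiff_mul (fun z => mul_nonneg (hc.space_nonneg _) (hc.time_nonneg _))
    (hc.exists_isOpen_eq_zero hR hR1)
  refine h1.trans ?_
  have hst : Ioo (-1 : ℝ) t ⊆ timeI 1 := by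
    rw [timeI_one]
    exact Ioo_subset_Ioo_right htm.2.le
  rw [setIntegral_QSet hmaj]
  refine (Real.le_norm_self _).trans ((norm_integral_le_of_norm_le hind.integrableOn
    (ae_restrict_of_ae_restrict_of_subset hst (h.ae_abs_integral_energyRhs_le hc hR hR1))).trans ?_)
  refine (setIntegral_le_integral hind (Filter.Eventually.of_forall hind0)).trans (le_of_eq ?_)
  exact integral_indicator measurableSet_Ioo

end SuitableWeakSolution

/-! ### The left-hand side of the local energy inequality -/

lemma IsCutoff.setIntegral_le {χ : E3 → ℝ} {θ : ℝ → ℝ} {M R : ℝ} (h : IsCutoff χ θ M R)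
    (hR1 : R ≤ 1) {t : ℝ} (ht : t ∈ timeI (R / 2)) {f : E3 → ℝ} (hf : IntegrableOn f (ballB 1))
    (hf0 : ∀ x, 0 ≤ f x) :
    ∫ x in ballB (R / 2), f x ≤ ∫ x in ballB 1, χ x * θ t * f x := by
  have hθ : θ t = 1 := h.time_eq_one t (by
    rw [abs_of_neg ht.2]
    linarith [ht.1])
  have hint : IntegrableOn (fun x => χ x * θ t * f x) (ballB 1) := by
    simp only [hθ, mul_one]
    refine Integrable.bdd_mul (c := 1) hf h.smooth_space.continuous.aestronglyMeasurable
      (Filter.Eventually.of_forall fun x => ?_)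
    rw [Real.norm_of_nonneg (h.space_nonneg x)]
    exact h.space_le_one x
  have h1 : ∫ x in ballB (R / 2), f x = ∫ x in ballB (R / 2), χ x * θ t * f x :=
    setIntegral_congr_fun (measurableSet_ballB _) fun x hx => by
      simp [hθ, h.space_eq_one x (mem_ballB.mp hx)]
  rw [h1]
  exact setIntegral_mono_set hint (Filter.Eventually.of_forall fun x =>
      mul_nonneg (mul_nonneg (h.space_nonneg _) (h.time_nonneg _)) (hf0 x))
    (ball_subset_ball (by linarith) : ballB (R / 2) ⊆ ballB 1).eventuallyLE

lemma setIntegral_Ioo_le_of_ae {f : ℝ → ℝ} {a b K : ℝ} (hf : IntegrableOn f (Ioo a b))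
    (hf0 : ∀ s, 0 ≤ f s) (hK : 0 ≤ K)
    (h : ∀ᵐ t ∂(volume.restrict (Ioo a b)), ∫ s in Ioo a t, f s ≤ K) :
    ∫ s in Ioo a b, f s ≤ K := by
  have hall : ∀ t < b, ∫ s in Ioo a t, f s ≤ K := by
    intro t ht
    rcases le_or_gt t a with hta | hta
    · rw [Ioo_eq_empty (not_lt.mpr hta)]
      simpa using hK
    · have h1 := ae_restrict_of_ae_restrict_of_subset
        (Ioo_subset_Ioo_left hta.le : Ioo t b ⊆ Ioo a b) h
      have : (ae (volume.restrict (Ioo t b))).NeBot := by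
        rw [ae_neBot, Ne, Measure.restrict_eq_zero, Real.volume_Ioo, ENNReal.ofReal_eq_zero]
        linarith
      obtain ⟨t', ht', htm⟩ := (h1.and (ae_restrict_mem measurableSet_Ioo)).exists
      refine le_trans ?_ ht'
      exact setIntegral_mono_set (hf.mono_set (Ioo_subset_Ioo_right htm.2.le))
        (Filter.Eventually.of_forall hf0) (Ioo_subset_Ioo_right htm.1.le).eventuallyLE
  have hU : ⋃ n : ℕ, Ioo a (b - 1 / (n + 1 : ℝ)) = Ioo a b := by
    ext x
    simp only [mem_iUnion, mem_Ioo]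
    constructor
    · rintro ⟨n, h1, h2⟩
      have : 0 < 1 / (n + 1 : ℝ) := by positivity
      exact ⟨h1, by linarith⟩
    · rintro ⟨h1, h2⟩
      obtain ⟨n, hn⟩ := exists_nat_one_div_lt (sub_pos.mpr h2)
      exact ⟨n, h1, by linarith⟩
  have hmono : Monotone fun n : ℕ => Ioo a (b - 1 / (n + 1 : ℝ)) := fun m n hmn =>
    Ioo_subset_Ioo_right (by gcongr)
  have hlim := tendsto_setIntegral_of_monotone (μ := volume) (f := f)
    (fun n : ℕ => (measurableSet_Ioo : MeasurableSet (Ioo a (b - 1 / (n + 1 : ℝ))))) hmono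
    (by rwa [hU])
  rw [hU] at hlim
  refine le_of_tendsto' hlim fun n => hall _ ?_
  have : 0 < 1 / (n + 1 : ℝ) := by positivity
  linarith

lemma essSup_le_of_ae_le_of_nonneg {α : Type*} [MeasurableSpace α] {μ : Measure α} (hμ : μ ≠ 0)
    {f : α → ℝ} {c : ℝ} (hf0 : ∀ x, 0 ≤ f x) (h : ∀ᵐ x ∂μ, f x ≤ c) : essSup f μ ≤ c := by
  have : (ae μ).NeBot := ae_neBot.mpr hμ
  exact Filter.limsup_le_of_le
    (Filter.isCoboundedUnder_le_of_le (ae μ) (x := 0) hf0) h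

namespace SuitableWeakSolution

variable {v : E3 → ℝ → E3} {gv : E3 → ℝ → Fin 3 → Fin 3 → ℝ} {p : E3 → ℝ → ℝ}
  {χ : E3 → ℝ} {θ : ℝ → ℝ} {M R : ℝ}

lemma integrableOn_mul_grad (h : SuitableWeakSolution v gv p) (hc : IsCutoff χ θ M R) :
    IntegrableOn (fun z : E3 × ℝ => χ z.1 * θ z.2 * ∑ i, ∑ j, (gv z.1 z.2 i j) ^ 2) (QSet 1) := by
  refine Integrable.bdd_mul (c := 1) h.vel.grad_L2 hc.contDiff_mul.continuous.aestronglyMeasurable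
    (Filter.Eventually.of_forall fun z => ?_)
  rw [Real.norm_of_nonneg (mul_nonneg (hc.space_nonneg _) (hc.time_nonneg _))]
  exact mul_le_one₀ (hc.space_le_one _) (hc.time_nonneg _) (hc.time_le_one _)

lemma funA_add_funE_le (h : SuitableWeakSolution v gv p) (hc : IsCutoff χ θ M R) (hM : 0 ≤ M)
    (hR : 0 < R) (hR1 : R ≤ 1) :
    funA v (R / 2) + funE gv (R / 2) ≤ 3 / R * ∫ z in QSet R, energyMajorant v p M R z := by
  set K := ∫ z in QSet R, energyMajorant v p M R z
  have hK : 0 ≤ K := integral_nonneg fun z => by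
    unfold energyMajorant
    positivity
  have hg0 : ∀ x s, 0 ≤ ∑ i, ∑ j, gv x s i j ^ 2 := fun x s =>
    Finset.sum_nonneg fun _ _ => Finset.sum_nonneg fun _ _ => sq_nonneg _
  have hcg0 : ∀ x s, 0 ≤ χ x * θ s * ∑ i, ∑ j, gv x s i j ^ 2 := fun x s =>
    mul_nonneg (mul_nonneg (hc.space_nonneg _) (hc.time_nonneg _)) (hg0 x s)
  have hsub : timeI (R / 2) ⊆ timeI 1 := Ioo_subset_Ioo_left (by nlinarith)
  have hen := ae_restrict_of_ae_restrict_of_subset hsub (h.ae_energy_le hc hM hR hR1)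
  have hv := ae_restrict_of_ae_restrict_of_subset hsub (ae_integrable_slice h.vel.v_L2)
  have hg := ae_restrict_of_ae_restrict_of_subset hsub (ae_integrable_slice h.vel.grad_L2)
  have hA : funA v (R / 2) ≤ 1 / (R / 2) * K := by
    refine essSup_le_of_ae_le_of_nonneg ?_ (fun t => mul_nonneg (by positivity)
      (integral_nonneg fun x => sq_nonneg _)) ?_
    · rw [Ne, Measure.restrict_eq_zero, timeI, Real.volume_Ioo, ENNReal.ofReal_eq_zero, not_le]
      have : 0 < (R / 2) ^ 2 := by positivity
      linarith
    · filter_upwards [hen, hv, ae_restrict_mem measurableSet_Ioo] with t h1 h2 ht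
      refine mul_le_mul_of_nonneg_left ?_ (by positivity)
      have h3 := hc.setIntegral_le hR1 ht h2 fun x => sq_nonneg _
      have h4 : 0 ≤ ∫ s in Ioo (-1 : ℝ) t, ∫ x in ballB 1,
          χ x * θ s * ∑ i, ∑ j, (gv x s i j) ^ 2 :=
        integral_nonneg fun s => integral_nonneg fun x => hcg0 x s
      linarith
  have hprod := h.integrableOn_mul_grad hc
  unfold IntegrableOn at hprod
  rw [volume_restrict_QSet] at hprod
  have hG : IntegrableOn (fun s => ∫ x in ballB 1, χ x * θ s * ∑ i, ∑ j, (gv x s i j) ^ 2)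
      (timeI 1) := hprod.integral_prod_right
  have hgR := h.vel.grad_L2.mono_set (QSet_subset (r := R / 2) (by linarith) (by linarith))
  unfold IntegrableOn at hgR
  rw [volume_restrict_QSet] at hgR
  have hEi : IntegrableOn (fun s => ∫ x in ballB (R / 2), ∑ i, ∑ j, (gv x s i j) ^ 2)
      (timeI (R / 2)) := hgR.integral_prod_right
  have hE : funE gv (R / 2) ≤ 1 / (R / 2) * (K / 2) := by
    refine mul_le_mul_of_nonneg_left ?_ (by positivity)
    refine setIntegral_Ioo_le_of_ae hEi
      (fun s => integral_nonneg fun x => hg0 x s) (by linarith) ?_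
    filter_upwards [hen, ae_restrict_mem measurableSet_Ioo] with t h1 ht
    have hst : Ioo (-(R / 2) ^ 2) t ⊆ timeI (R / 2) := Ioo_subset_Ioo_right ht.2.le
    have hst' : Ioo (-1 : ℝ) t ⊆ timeI 1 := by
      rw [timeI_one]
      exact Ioo_subset_Ioo_right ht.2.le
    have h2 : ∫ s in Ioo (-(R / 2) ^ 2) t, ∫ x in ballB (R / 2), ∑ i, ∑ j, (gv x s i j) ^ 2
        ≤ ∫ s in Ioo (-(R / 2) ^ 2) t, ∫ x in ballB 1, χ x * θ s * ∑ i, ∑ j, (gv x s i j) ^ 2 := by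
      refine integral_mono_ae (hEi.mono_set hst) (hG.mono_set (hst.trans hsub)) ?_
      filter_upwards [ae_restrict_of_ae_restrict_of_subset hst hg,
        ae_restrict_mem measurableSet_Ioo] with s h3 hs
      exact hc.setIntegral_le hR1 (hst hs) h3 fun x => hg0 x s
    have h3 : ∫ s in Ioo (-(R / 2) ^ 2) t, ∫ x in ballB 1, χ x * θ s * ∑ i, ∑ j, (gv x s i j) ^ 2
        ≤ ∫ s in Ioo (-1 : ℝ) t, ∫ x in ballB 1, χ x * θ s * ∑ i, ∑ j, (gv x s i j) ^ 2 :=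
      setIntegral_mono_set (hG.mono_set hst')
        (Filter.Eventually.of_forall fun s => integral_nonneg fun x => hcg0 x s)
        (Ioo_subset_Ioo_left (by nlinarith)).eventuallyLE
    have h4 : 0 ≤ ∫ x in ballB 1, χ x * θ t * ‖v x t‖ ^ 2 := integral_nonneg fun x =>
      mul_nonneg (mul_nonneg (hc.space_nonneg _) (hc.time_nonneg _)) (sq_nonneg _)
    linarith
  calc _ ≤ 1 / (R / 2) * K + 1 / (R / 2) * (K / 2) := add_le_add hA hE
    _ = 3 / R * K := by
      field_simp
      ring

end SuitableWeakSolution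

/-- Local energy estimate (2.2): there is a universal `c > 0` such that for every suitable
weak solution and every `0 < R ≤ 1`,
`A(R/2) + E(R/2) ≤ c [C^{2/3}(R) + C(R) + C^{1/3}(R) D₀^{2/3}(R)]`. -/
theorem local_energy_estimate_22 :
    ∃ c : ℝ, 0 < c ∧
      ∀ (v : E3 → ℝ → E3) (gv : E3 → ℝ → Fin 3 → Fin 3 → ℝ) (p : E3 → ℝ → ℝ),
        SuitableWeakSolution v gv p →
        ∀ R : ℝ, 0 < R → R ≤ 1 →
          funA v (R / 2) + funE gv (R / 2)
            ≤ c * (funC v R ^ ((2 : ℝ) / 3) + funC v R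
                + funC v R ^ ((1 : ℝ) / 3) * funD0 p R ^ ((2 : ℝ) / 3)) := by
  obtain ⟨M, hM, hcut⟩ := exists_isCutoff
  refine ⟨18 * M * (1 + (volume : Measure E3).real (ball 0 1) ^ (1 / 3 : ℝ)), by positivity,
    fun v gv p h R hR hR1 => ?_⟩
  obtain ⟨χ, θ, hc⟩ := hcut R hR
  refine (h.funA_add_funE_le hc hM.le hR hR1).trans ((mul_le_mul_of_nonneg_left
    (h.integral_energyMajorant_le hM.le hR hR1) (by positivity)).trans (le_of_eq ?_))
  field_simp
  ring
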